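/- arXiv:2211.10632 — 11 statements merged into one kernel-verified Lean document; each statement's English description precedes it below -/
import Mathlib

section
/- Discrete weak maximum (Hopf) principle: let Ω ⊆ ℤ×ℤ be a finite set and let p : ℤ×ℤ → ℝ satisfy p(i,j) = 0 for all (i,j) ∉ Ω and (L p)(i,j) ≤ 0 for all (i,j) ∈ Ω. Then p(i,j) ≥ 0 for all (i,j) ∈ ℤ×ℤ. -/
/-- The sum of the four coefficients. -/
noncomputable def Kcoef (k1 k2 k3 k4 : ℤ × ℤ → ℝ) (x : ℤ × ℤ) : ℝ :=
  k1 x + k2 x + k3 x + k4 x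

/-- The discrete elliptic (Reynolds) operator on the integer grid. -/
noncomputable def Lop (k1 k2 k3 k4 : ℤ × ℤ → ℝ) (p : ℤ × ℤ → ℝ) (x : ℤ × ℤ) : ℝ :=
  k1 x * p (x.1 + 1, x.2) + k2 x * p (x.1 - 1, x.2) +
  k3 x * p (x.1, x.2 + 1) + k4 x * p (x.1, x.2 - 1) -
  Kcoef k1 k2 k3 k4 x * p x

/-- Discrete weak maximum (Hopf) principle. -/
theorem discrete_weak_maximum_principle
    (k1 k2 k3 k4 : ℤ × ℤ → ℝ)
    (hk1 : ∀ x, 0 < k1 x) (hk2 : ∀ x, 0 < k2 x)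
    (hk3 : ∀ x, 0 < k3 x) (hk4 : ∀ x, 0 < k4 x)
    (Ω : Set (ℤ × ℤ)) (hΩ : Ω.Finite)
    (p : ℤ × ℤ → ℝ)
    (hbd : ∀ x ∉ Ω, p x = 0)
    (hsub : ∀ x ∈ Ω, Lop k1 k2 k3 k4 p x ≤ 0) :
    ∀ x : ℤ × ℤ, 0 ≤ p x := by
  by_contra! hneg
  obtain ⟨y, hy⟩ := hneg
  have mem_of_neg : ∀ z, p z < 0 → z ∈ Ω := fun z hz => by
    by_contra h
    exact hz.ne (hbd z h)
  obtain ⟨a, ha, hmin⟩ := Set.exists_min_image Ω p hΩ ⟨y, mem_of_neg y hy⟩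
  have ha_neg : p a < 0 := (hmin y (mem_of_neg y hy)).trans_lt hy
  have hle : ∀ z, p a ≤ p z := fun z => by
    by_cases hz : z ∈ Ω
    · exact hmin z hz
    · exact (hbd z hz).symm ▸ ha_neg.le
  -- Among the minimizers, take one with the largest first coordinate.
  obtain ⟨b, ⟨hb, hba⟩, hmax⟩ := Set.exists_max_image {z ∈ Ω | p z = p a} Prod.fst
    (hΩ.subset (Set.sep_subset _ _)) ⟨a, ha, rfl⟩
  have hright : p a < p (b.1 + 1, b.2) := by
    refine (hle _).lt_of_ne fun h => ?_
    have := hmax (b.1 + 1, b.2) ⟨mem_of_neg _ (h ▸ ha_neg), h.symm⟩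
    simp at this
  have hL := hsub b hb
  rw [Lop, Kcoef, hba] at hL
  have h1 := mul_lt_mul_of_pos_left hright (hk1 b)
  have h2 := mul_le_mul_of_nonneg_left (hle (b.1 - 1, b.2)) (hk2 b).le
  have h3 := mul_le_mul_of_nonneg_left (hle (b.1, b.2 + 1)) (hk3 b).le
  have h4 := mul_le_mul_of_nonneg_left (hle (b.1, b.2 - 1)) (hk4 b).le
  linarith
end

section
/- Discrete comparison principle: let Ω ⊆ ℤ×ℤ be a finite set and let p, q : ℤ×ℤ → ℝ satisfy p(i,j) = q(i,j) = 0 for all (i,j) ∉ Ω and (L p)(i,j) ≥ (L q)(i,j) for all (i,j) ∈ Ω. Then p(i,j) ≤ q(i,j) for all (i,j) ∈ ℤ×ℤ. -/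
theorem Lop_sub (k1 k2 k3 k4 p q : ℤ × ℤ → ℝ) (x : ℤ × ℤ) :
    Lop k1 k2 k3 k4 (p - q) x = Lop k1 k2 k3 k4 p x - Lop k1 k2 k3 k4 q x := by
  simp only [Lop, Pi.sub_apply]
  ring

/-- If `w` attains its maximum at `x` and is strictly smaller at the right neighbour,
then `L w` is negative at `x`. -/
theorem Lop_neg_of_isMax {k1 k2 k3 k4 w : ℤ × ℤ → ℝ} {x : ℤ × ℤ}
    (hk1 : 0 < k1 x) (hk2 : 0 ≤ k2 x) (hk3 : 0 ≤ k3 x) (hk4 : 0 ≤ k4 x)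
    (hmax : ∀ y, w y ≤ w x) (hlt : w (x.1 + 1, x.2) < w x) :
    Lop k1 k2 k3 k4 w x < 0 := by
  have h1 := mul_lt_mul_of_pos_left hlt hk1
  have h2 := mul_le_mul_of_nonneg_left (hmax (x.1 - 1, x.2)) hk2
  have h3 := mul_le_mul_of_nonneg_left (hmax (x.1, x.2 + 1)) hk3
  have h4 := mul_le_mul_of_nonneg_left (hmax (x.1, x.2 - 1)) hk4
  simp only [Lop, Kcoef]
  linarith

/-- Discrete weak maximum principle. -/
theorem nonpos_of_Lop_nonneg {k1 k2 k3 k4 w : ℤ × ℤ → ℝ}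
    (hk1 : ∀ x, 0 < k1 x) (hk2 : ∀ x, 0 ≤ k2 x)
    (hk3 : ∀ x, 0 ≤ k3 x) (hk4 : ∀ x, 0 ≤ k4 x)
    {Ω : Set (ℤ × ℤ)} (hΩ : Ω.Finite) (hbd : ∀ x ∉ Ω, w x ≤ 0)
    (hL : ∀ x ∈ Ω, 0 ≤ Lop k1 k2 k3 k4 w x) (x : ℤ × ℤ) : w x ≤ 0 := by
  by_contra! hx
  have hxΩ : x ∈ Ω := by
    by_contra h
    exact (hbd x h).not_gt hx
  obtain ⟨m, -, hm⟩ := Set.exists_max_image Ω w hΩ ⟨x, hxΩ⟩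
  have hpos : 0 < w m := hx.trans_le (hm x hxΩ)
  have hmax : ∀ y, w y ≤ w m := fun y => by
    by_cases hy : y ∈ Ω
    · exact hm y hy
    · exact (hbd y hy).trans hpos.le
  have mem_of_eq : ∀ y, w y = w m → y ∈ Ω := fun y hy => by
    by_contra h
    exact (hbd y h).not_gt (hy ▸ hpos)
  -- Among the maximum points, take one that lies furthest to the right.
  obtain ⟨z, hz, hright⟩ := Set.exists_max_image {y | w y = w m} Prod.fst
    (hΩ.subset mem_of_eq) ⟨m, rfl⟩
  have hzm : w z = w m := hz
  have hlt : w (z.1 + 1, z.2) < w z := by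
    refine lt_of_le_of_ne (hzm ▸ hmax _) fun h => ?_
    have := hright (z.1 + 1, z.2) (h.trans hzm)
    simp at this
  exact (hL z (mem_of_eq z hzm)).not_gt
    (Lop_neg_of_isMax (hk1 z) (hk2 z) (hk3 z) (hk4 z) (fun y => hzm ▸ hmax y) hlt)

/-- Discrete comparison principle. -/
theorem discrete_comparison_principle
    (k1 k2 k3 k4 : ℤ × ℤ → ℝ)
    (hk1 : ∀ x, 0 < k1 x) (hk2 : ∀ x, 0 < k2 x)
    (hk3 : ∀ x, 0 < k3 x) (hk4 : ∀ x, 0 < k4 x)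
    (Ω : Set (ℤ × ℤ)) (hΩ : Ω.Finite)
    (p q : ℤ × ℤ → ℝ)
    (hpbd : ∀ x ∉ Ω, p x = 0) (hqbd : ∀ x ∉ Ω, q x = 0)
    (hcmp : ∀ x ∈ Ω, Lop k1 k2 k3 k4 q x ≤ Lop k1 k2 k3 k4 p x) :
    ∀ x : ℤ × ℤ, p x ≤ q x := by
  intro x
  refine sub_nonpos.mp (nonpos_of_Lop_nonneg (w := p - q) hk1 (fun y => (hk2 y).le)
    (fun y => (hk3 y).le) (fun y => (hk4 y).le) hΩ (fun y hy => ?_) (fun y hy => ?_) x)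
  · simp [hpbd y hy, hqbd y hy]
  · rw [Lop_sub]
    exact sub_nonneg.mpr (hcmp y hy)
end

section
/- Numerical form of the strong Hopf theorem: let Ω ⊆ ℤ×ℤ be a finite grid-connected set and let p : ℤ×ℤ → ℝ be a solution on Ω for data D. If D(i,j) ≤ 0 for all (i,j) ∈ Ω and D(I,J) < 0 for at least one (I,J) ∈ Ω, then p(i,j) > 0 for every (i,j) ∈ Ω. -/
/-- Two grid points are adjacent if they differ by `(±1, 0)` or `(0, ±1)`. -/
def GridAdj (a b : ℤ × ℤ) : Prop :=
  (b.1 = a.1 + 1 ∧ b.2 = a.2) ∨ (b.1 = a.1 - 1 ∧ b.2 = a.2) ∨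
  (b.1 = a.1 ∧ b.2 = a.2 + 1) ∨ (b.1 = a.1 ∧ b.2 = a.2 - 1)

/-- A set is grid-connected if any two of its points can be joined by a path inside
the set whose consecutive points are grid-adjacent. -/
def GridConnected (Ω : Set (ℤ × ℤ)) : Prop :=
  ∀ a ∈ Ω, ∀ b ∈ Ω, Relation.ReflTransGen (fun x y => GridAdj x y ∧ y ∈ Ω) a b

/-- If `L p ≤ 0` at a point where `p` does not exceed its four neighbouring values, then
`p` takes the same value at all adjacent points. -/
theorem eq_of_gridAdj_of_Lop_nonpos {k1 k2 k3 k4 p : ℤ × ℤ → ℝ} {x y : ℤ × ℤ}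
    (hk1 : 0 < k1 x) (hk2 : 0 < k2 x) (hk3 : 0 < k3 x) (hk4 : 0 < k4 x)
    (hL : Lop k1 k2 k3 k4 p x ≤ 0) (hmin : ∀ z, p x ≤ p z) (hxy : GridAdj x y) :
    p y = p x := by
  obtain ⟨a, b⟩ := x
  obtain ⟨c, d⟩ := y
  simp only [Lop, Kcoef] at hL
  have h1 := mul_nonneg hk1.le (sub_nonneg.2 (hmin (a + 1, b)))
  have h2 := mul_nonneg hk2.le (sub_nonneg.2 (hmin (a - 1, b)))
  have h3 := mul_nonneg hk3.le (sub_nonneg.2 (hmin (a, b + 1)))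
  have h4 := mul_nonneg hk4.le (sub_nonneg.2 (hmin (a, b - 1)))
  refine le_antisymm (sub_nonpos.1 ?_) (hmin _)
  rcases hxy with ⟨h, h'⟩ | ⟨h, h'⟩ | ⟨h, h'⟩ | ⟨h, h'⟩ <;> simp only at h h' <;> subst h h'
  · exact nonpos_of_mul_nonpos_right (by linarith) hk1
  · exact nonpos_of_mul_nonpos_right (by linarith) hk2
  · exact nonpos_of_mul_nonpos_right (by linarith) hk3
  · exact nonpos_of_mul_nonpos_right (by linarith) hk4

/-- Weak minimum principle: if `L p ≤ 0` on a finite set and `p` vanishes outside it,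
then `p` is nonnegative. -/
theorem nonneg_of_Lop_nonpos {k1 k2 k3 k4 p : ℤ × ℤ → ℝ} {Ω : Set (ℤ × ℤ)}
    (hk1 : ∀ x, 0 < k1 x) (hk2 : ∀ x, 0 < k2 x)
    (hk3 : ∀ x, 0 < k3 x) (hk4 : ∀ x, 0 < k4 x) (hΩ : Ω.Finite)
    (hbd : ∀ x ∉ Ω, p x = 0) (hL : ∀ x ∈ Ω, Lop k1 k2 k3 k4 p x ≤ 0) (x : ℤ × ℤ) :
    0 ≤ p x := by
  by_contra! hx
  have mem_of_neg : ∀ y, p y < 0 → y ∈ Ω := fun y hy => by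
    by_contra h
    exact hy.ne (hbd y h)
  obtain ⟨m, hmΩ, hm⟩ := Set.exists_min_image Ω p hΩ ⟨x, mem_of_neg x hx⟩
  have hm0 : p m < 0 := (hm x (mem_of_neg x hx)).trans_lt hx
  have hmin : ∀ z, p m ≤ p z := fun z => by
    by_cases hz : z ∈ Ω
    · exact hm z hz
    · exact (hbd z hz).symm ▸ hm0.le
  obtain ⟨y, ⟨hyΩ, hy⟩, hmax⟩ := Set.exists_max_image {z ∈ Ω | p z = p m} Prod.fst
    (hΩ.subset (Set.sep_subset _ _)) ⟨m, hmΩ, rfl⟩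
  have hstep : p (y.1 + 1, y.2) = p y :=
    eq_of_gridAdj_of_Lop_nonpos (hk1 y) (hk2 y) (hk3 y) (hk4 y) (hL y hyΩ)
      (fun z => hy.symm ▸ hmin z) (Or.inl ⟨rfl, rfl⟩)
  have hle : y.1 + 1 ≤ y.1 :=
    hmax (y.1 + 1, y.2) ⟨mem_of_neg _ (by linarith), hstep.trans hy⟩
  omega

/-- Numerical form of the strong Hopf theorem. -/
theorem discrete_strong_hopf
    (k1 k2 k3 k4 : ℤ × ℤ → ℝ)
    (hk1 : ∀ x, 0 < k1 x) (hk2 : ∀ x, 0 < k2 x)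
    (hk3 : ∀ x, 0 < k3 x) (hk4 : ∀ x, 0 < k4 x)
    (D : ℤ × ℤ → ℝ)
    (Ω : Set (ℤ × ℤ)) (hΩ : Ω.Finite) (hconn : GridConnected Ω)
    (p : ℤ × ℤ → ℝ)
    (hbd : ∀ x ∉ Ω, p x = 0)
    (hsol : ∀ x ∈ Ω, Lop k1 k2 k3 k4 p x = D x)
    (hD : ∀ x ∈ Ω, D x ≤ 0)
    (hDneg : ∃ x ∈ Ω, D x < 0) :
    ∀ x ∈ Ω, 0 < p x := by
  intro x hx
  have hL : ∀ y ∈ Ω, Lop k1 k2 k3 k4 p y ≤ 0 := fun y hy => (hsol y hy).trans_le (hD y hy)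
  have hp := nonneg_of_Lop_nonpos hk1 hk2 hk3 hk4 hΩ hbd hL
  refine (hp x).lt_of_ne' fun hx0 => ?_
  have hzero : ∀ y, Relation.ReflTransGen (fun a b => GridAdj a b ∧ b ∈ Ω) x y →
      y ∈ Ω ∧ p y = 0 := fun y hxy => by
    induction hxy with
    | refl => exact ⟨hx, hx0⟩
    | @tail b c _ hbc ih =>
      refine ⟨hbc.2, ?_⟩
      rw [← ih.2]
      exact eq_of_gridAdj_of_Lop_nonpos (hk1 b) (hk2 b) (hk3 b) (hk4 b) (hL b ih.1)
        (fun z => ih.2.symm ▸ hp z) hbc.1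
  obtain ⟨y, hy, hDy⟩ := hDneg
  rw [← hsol y hy, Lop, (hzero y (hconn x hx y hy)).2] at hDy
  have h1 := mul_nonneg (hk1 y).le (hp (y.1 + 1, y.2))
  have h2 := mul_nonneg (hk2 y).le (hp (y.1 - 1, y.2))
  have h3 := mul_nonneg (hk3 y).le (hp (y.1, y.2 + 1))
  have h4 := mul_nonneg (hk4 y).le (hp (y.1, y.2 - 1))
  linarith
end

section
/- Closure of nonnegative-solution domains under union (discrete addition of boundary conditions): let Ω₁, Ω₂ ⊆ ℤ×ℤ be finite sets, let p₁ be a solution on Ω₁ with p₁ ≥ 0 everywhere, let p₂ be a solution on Ω₂ with p₂ ≥ 0 everywhere, and let p be a solution on Ω₁ ∪ Ω₂ (all for the same data D). Then p(i,j) ≥ max(p₁(i,j), p₂(i,j)) ≥ 0 for all (i,j) ∈ ℤ×ℤ; in particular the solution on Ω₁ ∪ Ω₂ is nonnegative everywhere. -/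
/-- `p` is a solution on `Ω` for data `D`: it vanishes outside `Ω` and satisfies the
discrete equation `L p = D` on `Ω`. -/
def IsSolutionOn (k1 k2 k3 k4 D : ℤ × ℤ → ℝ) (Ω : Set (ℤ × ℤ)) (p : ℤ × ℤ → ℝ) : Prop :=
  (∀ x ∉ Ω, p x = 0) ∧ (∀ x ∈ Ω, Lop k1 k2 k3 k4 p x = D x)

/-- Monotonicity of the operator in the neighbouring values. -/
lemma Lop_mono_of_eq {k1 k2 k3 k4 : ℤ × ℤ → ℝ}
    (hk1 : ∀ x, 0 < k1 x) (hk2 : ∀ x, 0 < k2 x)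
    (hk3 : ∀ x, 0 < k3 x) (hk4 : ∀ x, 0 < k4 x)
    {p q : ℤ × ℤ → ℝ} (h : ∀ y, p y ≤ q y) {x : ℤ × ℤ} (hx : q x = p x) :
    Lop k1 k2 k3 k4 p x ≤ Lop k1 k2 k3 k4 q x := by
  unfold Lop
  rw [hx]
  have h1 := mul_le_mul_of_nonneg_left (h (x.1 + 1, x.2)) (hk1 x).le
  have h2 := mul_le_mul_of_nonneg_left (h (x.1 - 1, x.2)) (hk2 x).le
  have h3 := mul_le_mul_of_nonneg_left (h (x.1, x.2 + 1)) (hk3 x).le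
  have h4 := mul_le_mul_of_nonneg_left (h (x.1, x.2 - 1)) (hk4 x).le
  linarith

/-- Comparison principle on a finite set. -/
lemma le_of_Lop_le {k1 k2 k3 k4 : ℤ × ℤ → ℝ}
    (hk1 : ∀ x, 0 < k1 x) (hk2 : ∀ x, 0 < k2 x)
    (hk3 : ∀ x, 0 < k3 x) (hk4 : ∀ x, 0 < k4 x)
    {Ω : Set (ℤ × ℤ)} (hΩ : Ω.Finite) {p q : ℤ × ℤ → ℝ}
    (hout : ∀ x ∉ Ω, q x ≤ p x)
    (hL : ∀ x ∈ Ω, Lop k1 k2 k3 k4 p x ≤ Lop k1 k2 k3 k4 q x) (x : ℤ × ℤ) :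
    q x ≤ p x := by
  by_contra! hx
  have hxΩ : x ∈ Ω := by
    by_contra h
    exact absurd (hout x h) (not_le.2 hx)
  obtain ⟨a, haΩ, ha⟩ := Set.exists_min_image Ω (fun y => p y - q y) hΩ ⟨x, hxΩ⟩
  have hneg : p a - q a < 0 := (ha x hxΩ).trans_lt (sub_neg.2 hx)
  have hmin : ∀ y, p a - q a ≤ p y - q y := by
    intro y
    by_cases hy : y ∈ Ω
    · exact ha y hy
    · linarith [hout y hy]
  -- A rightmost minimum point has a right neighbour with a strictly larger value.
  obtain ⟨b, ⟨hbΩ, hb⟩, hbmax⟩ := Set.exists_max_image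
    {y ∈ Ω | p y - q y = p a - q a} Prod.fst (hΩ.subset (Set.sep_subset _ _)) ⟨a, haΩ, rfl⟩
  have hright : p b - q b < p (b.1 + 1, b.2) - q (b.1 + 1, b.2) := by
    rw [hb]
    refine lt_of_le_of_ne (hmin _) fun heq => ?_
    by_cases hy : (b.1 + 1, b.2) ∈ Ω
    · have := hbmax _ ⟨hy, heq.symm⟩
      simp at this
    · linarith [hout _ hy]
  have h1 := mul_lt_mul_of_pos_left hright (hk1 b)
  have h2 := mul_le_mul_of_nonneg_left (hb.trans_le (hmin (b.1 - 1, b.2))) (hk2 b).le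
  have h3 := mul_le_mul_of_nonneg_left (hb.trans_le (hmin (b.1, b.2 + 1))) (hk3 b).le
  have h4 := mul_le_mul_of_nonneg_left (hb.trans_le (hmin (b.1, b.2 - 1))) (hk4 b).le
  have hLb := hL b hbΩ
  unfold Lop Kcoef at hLb
  linarith

/-- Closure of nonnegative-solution domains under union: the solution on the union of two
domains with nonnegative solutions dominates the pointwise maximum of the two solutions,
and in particular is nonnegative everywhere. -/
theorem union_of_nonneg_solution_domains
    (k1 k2 k3 k4 : ℤ × ℤ → ℝ)
    (hk1 : ∀ x, 0 < k1 x) (hk2 : ∀ x, 0 < k2 x)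
    (hk3 : ∀ x, 0 < k3 x) (hk4 : ∀ x, 0 < k4 x)
    (D : ℤ × ℤ → ℝ)
    (Ω1 Ω2 : Set (ℤ × ℤ)) (hΩ1 : Ω1.Finite) (hΩ2 : Ω2.Finite)
    (p1 p2 p : ℤ × ℤ → ℝ)
    (hp1 : IsSolutionOn k1 k2 k3 k4 D Ω1 p1) (hp1nn : ∀ x, 0 ≤ p1 x)
    (hp2 : IsSolutionOn k1 k2 k3 k4 D Ω2 p2) (hp2nn : ∀ x, 0 ≤ p2 x)
    (hp : IsSolutionOn k1 k2 k3 k4 D (Ω1 ∪ Ω2) p) :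
    ∀ x : ℤ × ℤ, max (p1 x) (p2 x) ≤ p x ∧ 0 ≤ max (p1 x) (p2 x) := by
  have hmono := @Lop_mono_of_eq k1 k2 k3 k4 hk1 hk2 hk3 hk4
  refine fun x => ⟨le_of_Lop_le hk1 hk2 hk3 hk4 (hΩ1.union hΩ2)
    (q := fun y => max (p1 y) (p2 y)) ?_ ?_ x, le_max_of_le_left (hp1nn x)⟩
  · intro y hy
    simp [hp.1 y hy, hp1.1 y fun h => hy (.inl h), hp2.1 y fun h => hy (.inr h)]
  · intro y hy
    rw [hp.2 y hy]
    have of_left (hy1 : y ∈ Ω1) (h : p2 y ≤ p1 y) :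
        D y ≤ Lop k1 k2 k3 k4 (fun y => max (p1 y) (p2 y)) y :=
      hp1.2 y hy1 ▸ hmono (fun _ => le_max_left _ _) (max_eq_left h)
    have of_right (hy2 : y ∈ Ω2) (h : p1 y ≤ p2 y) :
        D y ≤ Lop k1 k2 k3 k4 (fun y => max (p1 y) (p2 y)) y :=
      hp2.2 y hy2 ▸ hmono (fun _ => le_max_right _ _) (max_eq_right h)
    by_cases hy1 : y ∈ Ω1
    · by_cases hy2 : y ∈ Ω2
      · exact (le_total (p2 y) (p1 y)).elim (of_left hy1) (of_right hy2)
      · exact of_left hy1 (hp2.1 y hy2 ▸ hp1nn y)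
    · exact of_right (hy.resolve_left hy1) (hp1.1 y hy1 ▸ hp2nn y)
end

section
/- The solution on the greatest nonnegative-solution domain is nonnegative: the solution p⁰ on Ω⁰ satisfies p⁰(i,j) ≥ 0 for all (i,j) ∈ ℤ×ℤ. -/
/-- Strong minimum principle at a single point: if `u` attains a lower bound `m` at `x` and
`L u x ≤ 0`, then `u` attains `m` at the right neighbour of `x`. -/
theorem eq_right_neighbour_of_Lop_nonpos {k1 k2 k3 k4 u : ℤ × ℤ → ℝ} {x : ℤ × ℤ} {m : ℝ}
    (hk1 : 0 < k1 x) (hk2 : 0 ≤ k2 x) (hk3 : 0 ≤ k3 x) (hk4 : 0 ≤ k4 x)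
    (hm : ∀ y, m ≤ u y) (hx : u x = m) (hL : Lop k1 k2 k3 k4 u x ≤ 0) :
    u (x.1 + 1, x.2) = m := by
  refine le_antisymm ?_ (hm _)
  have h2 := mul_nonneg hk2 (sub_nonneg.2 (hm (x.1 - 1, x.2)))
  have h3 := mul_nonneg hk3 (sub_nonneg.2 (hm (x.1, x.2 + 1)))
  have h4 := mul_nonneg hk4 (sub_nonneg.2 (hm (x.1, x.2 - 1)))
  simp only [Lop, Kcoef, hx] at hL
  have h1 : k1 x * u (x.1 + 1, x.2) ≤ k1 x * m := by linarith
  exact le_of_mul_le_mul_left h1 hk1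

/-- The solution on the greatest nonnegative-solution domain (the union `Ω⁰` of all
subdomains of the computation domain whose solution is nonnegative everywhere) is
itself nonnegative everywhere. -/
theorem solution_on_greatest_domain_nonneg
    (k1 k2 k3 k4 : ℤ × ℤ → ℝ)
    (hk1 : ∀ x, 0 < k1 x) (hk2 : ∀ x, 0 < k2 x)
    (hk3 : ∀ x, 0 < k3 x) (hk4 : ∀ x, 0 < k4 x)
    (D : ℤ × ℤ → ℝ)
    (ΩD : Set (ℤ × ℤ)) (hΩD : ΩD.Finite)
    (Ω0 : Set (ℤ × ℤ))
    (hΩ0 : Ω0 = ⋃₀ {Ω : Set (ℤ × ℤ) | Ω ⊆ ΩD ∧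
      ∃ p : ℤ × ℤ → ℝ, IsSolutionOn k1 k2 k3 k4 D Ω p ∧ ∀ x, 0 ≤ p x})
    (p0 : ℤ × ℤ → ℝ)
    (hp0 : IsSolutionOn k1 k2 k3 k4 D Ω0 p0) :
    ∀ x : ℤ × ℤ, 0 ≤ p0 x := by
  subst hΩ0
  set F : Set (Set (ℤ × ℤ)) := {Ω | Ω ⊆ ΩD ∧
    ∃ p : ℤ × ℤ → ℝ, IsSolutionOn k1 k2 k3 k4 D Ω p ∧ ∀ x, 0 ≤ p x}
  have hFfin : F.Finite := hΩD.finite_subsets.subset fun Ω h => h.1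
  have hex : ∀ Ω, ∃ p : ℤ × ℤ → ℝ, Ω ∈ F → IsSolutionOn k1 k2 k3 k4 D Ω p ∧ ∀ x, 0 ≤ p x := by
    intro Ω
    by_cases h : Ω ∈ F
    · obtain ⟨-, p, hp⟩ := h
      exact ⟨p, fun _ => hp⟩
    · exact ⟨0, fun h' => absurd h' h⟩
  choose P hP using hex
  have houtside : ∀ x ∉ ΩD, ∀ Ω ∈ F, p0 x - P Ω x = 0 := by
    intro x hx Ω hΩ
    rw [hp0.1 x fun ⟨Ω', hΩ', hxΩ'⟩ => hx (hΩ'.1 hxΩ'), (hP Ω hΩ).1.1 x fun h => hx (hΩ.1 h),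
      sub_zero]
  by_contra! hneg
  obtain ⟨y, hy⟩ := hneg
  have hy0 : y ∈ ⋃₀ F := by
    by_contra h
    exact hy.ne (hp0.1 y h)
  obtain ⟨Ωy, hΩy, hyΩ⟩ := hy0
  obtain ⟨⟨z, Ωz⟩, ⟨hz, hΩz⟩, hmin⟩ := Set.exists_min_image (ΩD ×ˢ F)
    (fun a => p0 a.1 - P a.2 a.1) (hΩD.prod hFfin) ⟨(y, Ωy), hΩy.1 hyΩ, hΩy⟩
  set m := p0 z - P Ωz z
  have hm0 : m < 0 := by
    have h1 : m ≤ p0 y - P Ωy y := hmin (y, Ωy) ⟨hΩy.1 hyΩ, hΩy⟩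
    have h2 := (hP Ωy hΩy).2 y
    linarith
  have hle : ∀ Ω ∈ F, ∀ x, m ≤ (p0 - P Ω) x := by
    intro Ω hΩ x
    by_cases hx : x ∈ ΩD
    · exact hmin (x, Ω) ⟨hx, hΩ⟩
    · rw [Pi.sub_apply, houtside x hx Ω hΩ]
      exact hm0.le
  let M : Set (ℤ × ℤ) := {x | ∃ Ω ∈ F, p0 x - P Ω x = m}
  have hMD : M ⊆ ΩD := by
    rintro x ⟨Ω, hΩ, hx⟩
    by_contra h
    exact hm0.ne (hx.symm.trans (houtside x h Ω hΩ))
  have hstep : ∀ x ∈ M, (x.1 + 1, x.2) ∈ M := by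
    rintro x ⟨Ω, hΩ, hx⟩
    have hattained : ∃ Ω' ∈ F, x ∈ Ω' ∧ p0 x - P Ω' x = m := by
      by_cases hxΩ : x ∈ Ω
      · exact ⟨Ω, hΩ, hxΩ, hx⟩
      have hPx := (hP Ω hΩ).1.1 x hxΩ
      have hx0 : x ∈ ⋃₀ F := by
        by_contra h
        have := hp0.1 x h
        linarith
      obtain ⟨Ω', hΩ', hxΩ'⟩ := hx0
      refine ⟨Ω', hΩ', hxΩ', le_antisymm ?_ (hle Ω' hΩ' x)⟩
      have := (hP Ω' hΩ').2 x
      linarith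
    obtain ⟨Ω', hΩ', hxΩ', hx'⟩ := hattained
    refine ⟨Ω', hΩ', eq_right_neighbour_of_Lop_nonpos (u := p0 - P Ω') (hk1 x) (hk2 x).le
      (hk3 x).le (hk4 x).le (hle Ω' hΩ') hx' ?_⟩
    rw [Lop_sub, hp0.2 x ⟨Ω', hΩ', hxΩ'⟩, (hP Ω' hΩ').1.2 x hxΩ', sub_self]
  obtain ⟨x, hxM, hmax⟩ := Set.exists_max_image M Prod.fst (hΩD.subset hMD) ⟨z, Ωz, hΩz, rfl⟩
  exact absurd (hmax _ (hstep x hxM)) (by simp)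
end

section
/- Characterization of zero iteration error: a function p : ℤ×ℤ → ℝ with p(i,j) = 0 for all (i,j) ∉ Ω_D satisfies T(p) = p if and only if p solves the discrete complementarity problem on Ω_D. -/
/-- `p` solves the discrete complementarity (natural boundary) problem on `ΩD`. -/
def SolvesCP (k1 k2 k3 k4 D : ℤ × ℤ → ℝ) (ΩD : Set (ℤ × ℤ)) (p : ℤ × ℤ → ℝ) : Prop :=
  (∀ x ∉ ΩD, p x = 0) ∧ (∀ x, 0 ≤ p x) ∧
  (∀ x ∈ ΩD, Lop k1 k2 k3 k4 p x ≤ D x) ∧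
  (∀ x, 0 < p x → Lop k1 k2 k3 k4 p x = D x)

open Classical in
/-- The projected Jacobi iteration map. -/
noncomputable def Titer (k1 k2 k3 k4 D : ℤ × ℤ → ℝ) (ΩD : Set (ℤ × ℤ))
    (p : ℤ × ℤ → ℝ) (x : ℤ × ℤ) : ℝ :=
  if x ∈ ΩD then
    max 0 ((k1 x * p (x.1 + 1, x.2) + k2 x * p (x.1 - 1, x.2) +
            k3 x * p (x.1, x.2 + 1) + k4 x * p (x.1, x.2 - 1) - D x) /
           Kcoef k1 k2 k3 k4 x)
  else 0

/-- Scalar projected fixed point equation as a linear complementarity condition. -/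
theorem max_zero_div_eq_iff {K a q : ℝ} (hK : 0 < K) :
    max 0 (a / K) = q ↔ 0 ≤ q ∧ a ≤ K * q ∧ (0 < q → a = K * q) := by
  rw [← div_le_iff₀' hK, mul_comm K q, ← div_eq_iff hK.ne']
  grind

/-- Characterization of zero iteration error: a function vanishing outside `Ω_D` is a
fixed point of the projected Jacobi iteration iff it solves the discrete complementarity
problem on `Ω_D`. -/
theorem fixed_point_iff_solves_CP
    (k1 k2 k3 k4 : ℤ × ℤ → ℝ)
    (hk1 : ∀ x, 0 < k1 x) (hk2 : ∀ x, 0 < k2 x)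
    (hk3 : ∀ x, 0 < k3 x) (hk4 : ∀ x, 0 < k4 x)
    (D : ℤ × ℤ → ℝ)
    (ΩD : Set (ℤ × ℤ)) (hΩD : ΩD.Finite)
    (p : ℤ × ℤ → ℝ)
    (hbd : ∀ x ∉ ΩD, p x = 0) :
    Titer k1 k2 k3 k4 D ΩD p = p ↔ SolvesCP k1 k2 k3 k4 D ΩD p := by
  have hfix : ∀ x ∈ ΩD, (Titer k1 k2 k3 k4 D ΩD p x = p x ↔
      0 ≤ p x ∧ Lop k1 k2 k3 k4 p x ≤ D x ∧ (0 < p x → Lop k1 k2 k3 k4 p x = D x)) := by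
    intro x hx
    have hK : 0 < Kcoef k1 k2 k3 k4 x :=
      add_pos (add_pos (add_pos (hk1 x) (hk2 x)) (hk3 x)) (hk4 x)
    rw [Titer, if_pos hx, max_zero_div_eq_iff hK, Lop, sub_le_iff_le_add,
      sub_le_iff_le_add, sub_eq_iff_eq_add, sub_eq_iff_eq_add, add_comm (D x)]
  constructor
  · intro h
    have h' x (hx : x ∈ ΩD) := (hfix x hx).1 (congrFun h x)
    refine ⟨hbd, fun x ↦ ?_, fun x hx ↦ (h' x hx).2.1, fun x hpos ↦ ?_⟩
    · by_cases hx : x ∈ ΩD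
      · exact (h' x hx).1
      · exact (hbd x hx).ge
    · have hx : x ∈ ΩD := by
        by_contra hx
        exact hpos.ne' (hbd x hx)
      exact (h' x hx).2.2 hpos
  · rintro ⟨-, hnonneg, hle, heq⟩
    ext x
    by_cases hx : x ∈ ΩD
    · exact (hfix x hx).2 ⟨hnonneg x, hle x hx, heq x⟩
    · rw [Titer, if_neg hx, hbd x hx]
end

section
/- Convergence of the iteration to the unique natural-boundary solution: suppose p* : ℤ×ℤ → ℝ solves the discrete complementarity problem on Ω_D. Then the iterates p⁽ⁿ⁾ = Tⁿ(0) started from the identically-zero function satisfy p⁽ⁿ⁾(i,j) ≤ p*(i,j) for all n and all (i,j), and p⁽ⁿ⁾ converges pointwise as n → ∞ to a function p∞ with T(p∞) = p∞; hence p∞ = p* whenever the complementarity solution is unique. -/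
section ProjectedJacobi

variable {k1 k2 k3 k4 D : ℤ × ℤ → ℝ} {ΩD : Set (ℤ × ℤ)} {p : ℤ × ℤ → ℝ}

lemma Kcoef_pos (hk1 : ∀ x, 0 < k1 x) (hk2 : ∀ x, 0 < k2 x) (hk3 : ∀ x, 0 < k3 x)
    (hk4 : ∀ x, 0 < k4 x) (x : ℤ × ℤ) : 0 < Kcoef k1 k2 k3 k4 x := by
  have := hk1 x
  have := hk2 x
  have := hk3 x
  have := hk4 x
  unfold Kcoef
  positivity

lemma Titer_of_mem {x : ℤ × ℤ} (hK : 0 < Kcoef k1 k2 k3 k4 x) (hx : x ∈ ΩD) :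
    Titer k1 k2 k3 k4 D ΩD p x =
      max 0 (p x + (Lop k1 k2 k3 k4 p x - D x) / Kcoef k1 k2 k3 k4 x) := by
  rw [Titer, if_pos hx, Lop]
  congr 1
  field_simp
  ring

lemma Titer_of_notMem {x : ℤ × ℤ} (hx : x ∉ ΩD) : Titer k1 k2 k3 k4 D ΩD p x = 0 :=
  if_neg hx

lemma Titer_nonneg (x : ℤ × ℤ) : 0 ≤ Titer k1 k2 k3 k4 D ΩD p x := by
  unfold Titer
  split_ifs
  exacts [le_max_left _ _, le_rfl]

lemma monotone_Titer (hk1 : ∀ x, 0 < k1 x) (hk2 : ∀ x, 0 < k2 x) (hk3 : ∀ x, 0 < k3 x)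
    (hk4 : ∀ x, 0 < k4 x) : Monotone (Titer k1 k2 k3 k4 D ΩD) := by
  intro p q hpq x
  have h1 := (hk1 x).le
  have h2 := (hk2 x).le
  have h3 := (hk3 x).le
  have h4 := (hk4 x).le
  have hK := (Kcoef_pos hk1 hk2 hk3 hk4 x).le
  unfold Titer
  split_ifs
  · gcongr <;> apply hpq
  · exact le_rfl

lemma continuous_Titer : Continuous (Titer k1 k2 k3 k4 D ΩD) := by
  refine continuous_pi fun x => ?_
  unfold Titer
  split_ifs <;> fun_prop

lemma SolvesCP.Titer_eq_self (hK : ∀ x, 0 < Kcoef k1 k2 k3 k4 x)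
    (hp : SolvesCP k1 k2 k3 k4 D ΩD p) : Titer k1 k2 k3 k4 D ΩD p = p := by
  obtain ⟨hout, hnonneg, hle, heq⟩ := hp
  funext x
  by_cases hx : x ∈ ΩD
  · rw [Titer_of_mem (hK x) hx]
    rcases (hnonneg x).eq_or_lt with h0 | hpos
    · rw [← h0, zero_add]
      exact max_eq_left (div_nonpos_of_nonpos_of_nonneg (sub_nonpos.2 (hle x hx)) (hK x).le)
    · rw [heq x hpos, sub_self, zero_div, add_zero]
      exact max_eq_right hpos.le
  · rw [Titer_of_notMem hx, hout x hx]

lemma SolvesCP.of_Titer_eq_self (hK : ∀ x, 0 < Kcoef k1 k2 k3 k4 x)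
    (hp : Titer k1 k2 k3 k4 D ΩD p = p) : SolvesCP k1 k2 k3 k4 D ΩD p := by
  have hout : ∀ x ∉ ΩD, p x = 0 := fun x hx => by rw [← hp, Titer_of_notMem hx]
  have hmax : ∀ x ∈ ΩD,
      max 0 (p x + (Lop k1 k2 k3 k4 p x - D x) / Kcoef k1 k2 k3 k4 x) = p x :=
    fun x hx => by rw [← Titer_of_mem (hK x) hx, hp]
  refine ⟨hout, fun x => ?_, fun x hx => ?_, fun x hpos => ?_⟩
  · rw [← hp]
    exact Titer_nonneg x
  · have h := (le_max_right _ _).trans_eq (hmax x hx)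
    have hdiv : (Lop k1 k2 k3 k4 p x - D x) / Kcoef k1 k2 k3 k4 x ≤ 0 := by linarith
    rw [div_le_iff₀ (hK x), zero_mul] at hdiv
    exact sub_nonpos.1 hdiv
  · have hx : x ∈ ΩD := by
      by_contra hx
      exact hpos.ne' (hout x hx)
    have hdiv : (Lop k1 k2 k3 k4 p x - D x) / Kcoef k1 k2 k3 k4 x = 0 := by
      rcases max_choice 0 (p x + (Lop k1 k2 k3 k4 p x - D x) / Kcoef k1 k2 k3 k4 x) with h | h <;>
        linarith [hmax x hx]
    exact sub_eq_zero.1 ((div_eq_zero_iff.1 hdiv).resolve_right (hK x).ne')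

end ProjectedJacobi

open Filter Topology in
/-- Convergence of the projected Jacobi iteration started from zero to the unique
natural-boundary (complementarity) solution. -/
theorem iteration_converges_to_CP_solution
    (k1 k2 k3 k4 : ℤ × ℤ → ℝ)
    (hk1 : ∀ x, 0 < k1 x) (hk2 : ∀ x, 0 < k2 x)
    (hk3 : ∀ x, 0 < k3 x) (hk4 : ∀ x, 0 < k4 x)
    (D : ℤ × ℤ → ℝ)
    (ΩD : Set (ℤ × ℤ)) (hΩD : ΩD.Finite)
    (pstar : ℤ × ℤ → ℝ)
    (hpstar : SolvesCP k1 k2 k3 k4 D ΩD pstar) :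
    (∀ (n : ℕ) (x : ℤ × ℤ),
        (Titer k1 k2 k3 k4 D ΩD)^[n] (fun _ => 0) x ≤ pstar x) ∧
    ∃ pinf : ℤ × ℤ → ℝ,
      (∀ x : ℤ × ℤ,
          Tendsto (fun n : ℕ => (Titer k1 k2 k3 k4 D ΩD)^[n] (fun _ => 0) x)
            atTop (𝓝 (pinf x))) ∧
      Titer k1 k2 k3 k4 D ΩD pinf = pinf ∧
      ((∀ q r : ℤ × ℤ → ℝ, SolvesCP k1 k2 k3 k4 D ΩD q →
          SolvesCP k1 k2 k3 k4 D ΩD r → q = r) → pinf = pstar) := by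
  have hK := Kcoef_pos hk1 hk2 hk3 hk4
  have hmono := monotone_Titer (D := D) (ΩD := ΩD) hk1 hk2 hk3 hk4
  have hbound : ∀ (n : ℕ) (x : ℤ × ℤ),
      (Titer k1 k2 k3 k4 D ΩD)^[n] (fun _ => 0) x ≤ pstar x := fun n x => by
    have h := hmono.iterate n (show (fun _ => 0) ≤ pstar from hpstar.2.1) x
    rwa [Function.iterate_fixed (hpstar.Titer_eq_self hK)] at h
  have hseq : Monotone fun n : ℕ => (Titer k1 k2 k3 k4 D ΩD)^[n] (fun _ => 0) :=
    hmono.monotone_iterate_of_le_map fun x => Titer_nonneg x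
  have hlim : ∀ x, Tendsto (fun n : ℕ => (Titer k1 k2 k3 k4 D ΩD)^[n] (fun _ => 0) x) atTop
      (𝓝 (⨆ n : ℕ, (Titer k1 k2 k3 k4 D ΩD)^[n] (fun _ => 0) x)) := fun x =>
    tendsto_atTop_ciSup (fun _ _ hmn => hseq hmn x)
      ⟨pstar x, Set.forall_mem_range.2 fun n => hbound n x⟩
  have hfix := isFixedPt_of_tendsto_iterate (tendsto_pi_nhds.2 hlim)
    continuous_Titer.continuousAt
  exact ⟨hbound, _, hlim, hfix, fun huniq => huniq _ _ (.of_Titer_eq_self hK hfix) hpstar⟩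
end

section
/- Weak maximum (Hopf) principle for the Reynolds operator: let U ⊆ ℝ² be a bounded open set and let p : ℝ² → ℝ be continuous on ℝ² and twice continuously differentiable on U, with (L p)(x,y) ≤ 0 for all (x,y) ∈ U and p = 0 at every point of the frontier of U. Then p(x,y) ≥ 0 for all (x,y) ∈ U. -/
/-- Partial derivative in the `x` direction. -/
noncomputable def pdx (g : ℝ × ℝ → ℝ) (z : ℝ × ℝ) : ℝ := fderiv ℝ g z (1, 0)

/-- Partial derivative in the `y` direction. -/
noncomputable def pdy (g : ℝ × ℝ → ℝ) (z : ℝ × ℝ) : ℝ := fderiv ℝ g z (0, 1)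

/-- The steady Reynolds operator
`(L p)(x,y) = ∂/∂x (f₁ ∂p/∂x) + ∂/∂y (f₂ ∂p/∂y)`. -/
noncomputable def ReynoldsOp (f1 f2 : ℝ × ℝ → ℝ) (p : ℝ × ℝ → ℝ) (z : ℝ × ℝ) : ℝ :=
  pdx (fun w => f1 w * pdx p w) z + pdy (fun w => f2 w * pdy p w) z

/-- Second-order necessary condition at a local minimum, along a direction `v`. -/
theorem IsLocalMin.fderiv_fderiv_nonneg {E : Type*} [NormedAddCommGroup E] [NormedSpace ℝ E]
    {g : E → ℝ} {z : E} (hmin : IsLocalMin g z) (hg : ContDiffAt ℝ 2 g z) (v : E) :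
    0 ≤ fderiv ℝ (fun w => fderiv ℝ g w v) z v := by
  set l : ℝ → E := fun t => z + t • v with hl
  have hl0 : l 0 = z := by simp [hl]
  have hlc : Continuous l := by fun_prop
  have hld : ∀ t, HasDerivAt l v t := fun t => by
    simpa only [one_smul, id] using ((hasDerivAt_id t).smul_const v).const_add z
  have hlt : Filter.Tendsto l (nhds 0) (nhds z) := by
    simpa [hl0] using hlc.tendsto 0
  have hderiv : deriv (g ∘ l) =ᶠ[nhds 0] fun t => fderiv ℝ g (l t) v := by
    filter_upwards [hlt.eventually (hg.eventually (by simp))] with t ht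
    exact ((ht.differentiableAt (by norm_num)).hasFDerivAt.comp_hasDerivAt t (hld t)).deriv
  have hdiff : DifferentiableAt ℝ (fun w => fderiv ℝ g w v) z :=
    ((hg.fderiv_right (m := 1) (by norm_num)).differentiableAt (by norm_num)).clm_apply
      (differentiableAt_const v)
  have hsecond : deriv (deriv (g ∘ l)) 0 = fderiv ℝ (fun w => fderiv ℝ g w v) z v := by
    rw [hderiv.deriv_eq]
    rw [← hl0] at hdiff
    simpa [Function.comp_def, hl0] using (hdiff.hasFDerivAt.comp_hasDerivAt 0 (hld 0)).deriv
  have hmin' : IsLocalMin (g ∘ l) 0 := by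
    have := hlt.eventually hmin
    simpa [IsLocalMin, IsMinFilter, hl0] using this
  rw [← hsecond]
  by_contra! hneg
  have hmax : IsLocalMax (g ∘ l) 0 := by
    refine isLocalMax_of_deriv_deriv_neg hneg hmin'.deriv_eq_zero ?_
    refine ContinuousAt.comp ?_ hlc.continuousAt
    rw [hl0]
    exact hg.continuousAt
  have hconst : g ∘ l =ᶠ[nhds 0] fun _ => (g ∘ l) 0 := by
    filter_upwards [hmin', hmax] with t h1 h2
    exact le_antisymm h2 h1
  have hzero := hconst.deriv.deriv_eq
  simp at hzero
  exact hneg.ne hzero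

/-- The derivative of the barrier `w ↦ exp (k * w.1)`. -/
theorem fderiv_exp_mul_fst (k : ℝ) (w v : ℝ × ℝ) :
    fderiv ℝ (fun w : ℝ × ℝ => Real.exp (k * w.1)) w v = k * Real.exp (k * w.1) * v.1 := by
  have h := ((hasFDerivAt_fst (𝕜 := ℝ) (p := w)).const_mul k).exp
  rw [h.fderiv]
  simp
  ring

/-- If `p - ε exp (k x)` has a local minimum at `z`, then the Reynolds operator of `p` at `z` is at
least that of `ε exp (k x)`. -/
theorem ReynoldsOp.ge_of_isLocalMin_sub_exp {f1 f2 p : ℝ × ℝ → ℝ} {z : ℝ × ℝ} {ε k : ℝ}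
    (hf1 : DifferentiableAt ℝ f1 z) (hf2 : DifferentiableAt ℝ f2 z)
    (hf1pos : 0 ≤ f1 z) (hf2pos : 0 ≤ f2 z) (hp : ContDiffAt ℝ 2 p z)
    (hmin : IsLocalMin (fun w => p w - ε * Real.exp (k * w.1)) z) :
    ε * k * Real.exp (k * z.1) * (pdx f1 z + k * f1 z) ≤ ReynoldsOp f1 f2 p z := by
  have hexp : ContDiff ℝ 2 (fun w : ℝ × ℝ => Real.exp (k * w.1)) := by fun_prop
  have hexpd : Differentiable ℝ (fun w : ℝ × ℝ => Real.exp (k * w.1)) := by fun_prop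
  have hq : ContDiffAt ℝ 2 (fun w => p w - ε * Real.exp (k * w.1)) z :=
    hp.sub (contDiffAt_const.mul hexp.contDiffAt)
  have hpd : ∀ v, DifferentiableAt ℝ (fun w => fderiv ℝ p w v) z := fun v =>
    ((hp.fderiv_right (m := 1) (by norm_num)).differentiableAt (by norm_num)).clm_apply
      (differentiableAt_const v)
  have hfirst : ∀ w, DifferentiableAt ℝ p w → ∀ v,
      fderiv ℝ (fun w => p w - ε * Real.exp (k * w.1)) w v
        = fderiv ℝ p w v - ε * k * v.1 * Real.exp (k * w.1) := fun w hw v => by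
    rw [fderiv_fun_sub hw ((hexpd w).const_mul ε), fderiv_const_mul (hexpd w)]
    simp only [sub_apply, smul_apply,
      fderiv_exp_mul_fst, smul_eq_mul]
    ring
  have hgrad : ∀ v, fderiv ℝ p z v = ε * k * v.1 * Real.exp (k * z.1) := fun v => by
    have h := hfirst z (hp.differentiableAt (by norm_num)) v
    rw [hmin.fderiv_eq_zero] at h
    simp only [zero_apply] at h
    linarith
  have hhess : ∀ v, ε * k ^ 2 * v.1 ^ 2 * Real.exp (k * z.1)
      ≤ fderiv ℝ (fun w => fderiv ℝ p w v) z v := fun v => by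
    have h := hmin.fderiv_fderiv_nonneg hq v
    have heq : (fun w => fderiv ℝ (fun w => p w - ε * Real.exp (k * w.1)) w v) =ᶠ[nhds z]
        fun w => fderiv ℝ p w v - ε * k * v.1 * Real.exp (k * w.1) := by
      filter_upwards [hp.eventually (by simp)] with w hw
      exact hfirst w (hw.differentiableAt (by norm_num)) v
    rw [heq.fderiv_eq, fderiv_fun_sub (hpd v) ((hexpd z).const_mul _),
      fderiv_const_mul (hexpd z)] at h
    simp only [sub_apply, smul_apply,
      fderiv_exp_mul_fst, smul_eq_mul] at h
    linarith
  have hx := mul_le_mul_of_nonneg_left (hhess (1, 0)) hf1pos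
  have hy := mul_le_mul_of_nonneg_left (hhess (0, 1)) hf2pos
  unfold ReynoldsOp pdx pdy
  rw [fderiv_fun_mul hf1 (hpd _), fderiv_fun_mul hf2 (hpd _)]
  simp only [add_apply, smul_apply, smul_eq_mul, hgrad]
  norm_num at hx hy ⊢
  linarith

/-- Weak maximum (Hopf) principle for the Reynolds operator. -/
theorem reynolds_weak_maximum_principle
    (f1 f2 : ℝ × ℝ → ℝ)
    (hf1 : ContDiff ℝ 1 f1) (hf2 : ContDiff ℝ 1 f2)
    (hf1pos : ∀ z, 0 < f1 z) (hf2pos : ∀ z, 0 < f2 z)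
    (U : Set (ℝ × ℝ)) (hUopen : IsOpen U) (hUbd : Bornology.IsBounded U)
    (p : ℝ × ℝ → ℝ)
    (hpcont : Continuous p)
    (hpC2 : ContDiffOn ℝ 2 p U)
    (hsub : ∀ z ∈ U, ReynoldsOp f1 f2 p z ≤ 0)
    (hbd : ∀ z ∈ frontier U, p z = 0) :
    ∀ z ∈ U, 0 ≤ p z := by
  intro z₀ hz₀
  by_contra! hneg
  have hK : IsCompact (closure U) := hUbd.isCompact_closure
  obtain ⟨C, hC⟩ : ∃ C, ∀ z ∈ closure U, ‖pdx f1 z / f1 z‖ ≤ C := by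
    refine hK.exists_bound_of_continuousOn (Continuous.continuousOn ?_)
    exact ((hf1.continuous_fderiv (by norm_num)).clm_apply continuous_const).div
      hf1.continuous fun z => (hf1pos z).ne'
  have hC0 : 0 ≤ C := (norm_nonneg _).trans (hC z₀ (subset_closure hz₀))
  set k := C + 1 with hk
  have hexp : Continuous fun w : ℝ × ℝ => Real.exp (k * w.1) := by fun_prop
  obtain ⟨M, hM⟩ := hK.exists_bound_of_continuousOn hexp.continuousOn
  have hM0 : 0 < M := (norm_pos_iff.2 (Real.exp_ne_zero _)).trans_le (hM z₀ (subset_closure hz₀))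
  set ε := -p z₀ / M with hε
  have hεpos : 0 < ε := div_pos (neg_pos.2 hneg) hM0
  have hεM : ε * M = -p z₀ := div_mul_cancel₀ _ hM0.ne'
  obtain ⟨z, hzK, hzmin⟩ := hK.exists_isMinOn ⟨z₀, subset_closure hz₀⟩
    (hpcont.sub (hexp.const_mul ε)).continuousOn
  have hzU : z ∈ U := by
    by_contra hzU
    have hpz : p z = 0 := hbd z (by rw [hUopen.frontier_eq]; exact ⟨hzK, hzU⟩)
    have h1 : p z - ε * Real.exp (k * z.1) ≤ p z₀ - ε * Real.exp (k * z₀.1) :=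
      hzmin (subset_closure hz₀)
    have h2 := mul_le_mul_of_nonneg_left ((le_abs_self _).trans (hM z hzK)) hεpos.le
    have h3 := mul_pos hεpos (Real.exp_pos (k * z₀.1))
    linarith
  have hlow := ReynoldsOp.ge_of_isLocalMin_sub_exp
    (hf1.differentiable (by norm_num) z) (hf2.differentiable (by norm_num) z)
    (hf1pos z).le (hf2pos z).le (hpC2.contDiffAt (hUopen.mem_nhds hzU))
    (hzmin.isLocalMin (Filter.mem_of_superset (hUopen.mem_nhds hzU) subset_closure))
  have hpos : 0 < pdx f1 z + k * f1 z := by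
    have h1 := (abs_le.1 (hC z hzK)).1
    rw [le_div_iff₀ (hf1pos z)] at h1
    linarith [hf1pos z]
  have hkpos : 0 < k := by linarith
  have : 0 < ε * k * Real.exp (k * z.1) * (pdx f1 z + k * f1 z) := by positivity
  linarith [hsub z hzU]
end

section
/- Closure of positive boundary conditions under addition (continuous case): let Ω_A, Ω_B ⊆ ℝ² be bounded open sets. Suppose p_A : ℝ² → ℝ is continuous, vanishes outside Ω_A, is twice continuously differentiable on Ω_A, satisfies (L p_A)(x,y) = f₃(x,y) for all (x,y) ∈ Ω_A, and p_A ≥ 0 on ℝ²; suppose p_B satisfies the same conditions with Ω_B in place of Ω_A. Suppose further that p : ℝ² → ℝ is continuous, vanishes outside Ω_A ∪ Ω_B, is twice continuously differentiable on Ω_A ∪ Ω_B, and satisfies (L p)(x,y) = f₃(x,y) for all (x,y) ∈ Ω_A ∪ Ω_B. Then p(x,y) ≥ max(p_A(x,y), p_B(x,y)) ≥ 0 for all (x,y) ∈ ℝ²; in particular the solution on the union Ω_A ∪ Ω_B is again nonnegative. -/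
open Set Filter Topology

section SecondOrder

variable {E : Type*} [NormedAddCommGroup E] [NormedSpace ℝ E]

/-- If `g` has a local minimum at `t`, then its second derivative there is nonnegative. -/
theorem IsLocalMin.deriv_deriv_nonneg {g : ℝ → ℝ} {t : ℝ} (h : IsLocalMin g t)
    (hg : ContinuousAt g t) : 0 ≤ deriv (deriv g) t := by
  by_contra! hneg
  have hmax : IsLocalMax g t := isLocalMax_of_deriv_deriv_neg hneg h.deriv_eq_zero hg
  have hconst : g =ᶠ[𝓝 t] fun _ => g t := by
    filter_upwards [h, hmax] with s h1 h2 using le_antisymm h2 h1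
  have hzero : deriv (deriv g) t = 0 := by
    rw [hconst.deriv.deriv_eq]
    simp
  exact hneg.ne hzero

theorem ContDiffAt.differentiableAt_fderiv_apply {v : E → ℝ} {z : E} (hv : ContDiffAt ℝ 2 v z)
    (e : E) : DifferentiableAt ℝ (fun w => fderiv ℝ v w e) z :=
  ((hv.fderiv_right (m := 1) (by norm_num)).differentiableAt (by norm_num)).clm_apply
    (differentiableAt_const e)

theorem ContDiffAt.eventually_differentiableAt {v : E → ℝ} {z : E} (hv : ContDiffAt ℝ 2 v z) :
    ∀ᶠ w in 𝓝 z, DifferentiableAt ℝ v w :=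
  (hv.eventually (by simp)).mono fun _ hw => hw.differentiableAt (by norm_num)

/-- At a local minimum the second derivative in any direction is nonnegative. -/
theorem IsLocalMin.fderiv_fderiv_apply_nonneg {v : E → ℝ} {z : E} (h : IsLocalMin v z)
    (hv : ContDiffAt ℝ 2 v z) (e : E) : 0 ≤ fderiv ℝ (fun w => fderiv ℝ v w e) z e := by
  have hline : ∀ t : ℝ, HasDerivAt (fun s : ℝ => z + s • e) e t := fun t => by
    simpa using ((hasDerivAt_id t).smul_const e).const_add z
  have hz : z + (0 : ℝ) • e = z := by simp
  have hcont : Tendsto (fun s : ℝ => z + s • e) (𝓝 0) (𝓝 z) := by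
    simpa using (hline 0).continuousAt.tendsto
  have hderiv : deriv (fun s : ℝ => v (z + s • e)) =ᶠ[𝓝 0] fun s => fderiv ℝ v (z + s • e) e := by
    filter_upwards [hcont.eventually hv.eventually_differentiableAt] with s hs
    exact (hs.hasFDerivAt.comp_hasDerivAt s (hline s)).deriv
  have hsecond : HasDerivAt (fun s : ℝ => fderiv ℝ v (z + s • e) e)
      (fderiv ℝ (fun w => fderiv ℝ v w e) z e) 0 := by
    have hd := (hv.differentiableAt_fderiv_apply e).hasFDerivAt
    exact HasFDerivAt.comp_hasDerivAt (x := (0 : ℝ)) (f := fun s : ℝ => z + s • e)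
      (l := fun w => fderiv ℝ v w e) (by rwa [hz]) (hline 0)
  have hmin : IsLocalMin (fun s : ℝ => v (z + s • e)) 0 := by
    have := hcont.eventually h
    simpa [IsLocalMin, IsMinFilter] using this
  have hc : ContinuousAt (fun s : ℝ => v (z + s • e)) 0 := by
    have := hv.continuousAt.tendsto.comp hcont
    simpa [ContinuousAt, Function.comp_def] using this
  have := hmin.deriv_deriv_nonneg hc
  rwa [hderiv.deriv_eq, hsecond.deriv] at this

theorem fderiv_mul_fderiv_apply {f v : E → ℝ} {z : E} (hf : DifferentiableAt ℝ f z)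
    (hv : ContDiffAt ℝ 2 v z) (e : E) :
    fderiv ℝ (fun w => f w * fderiv ℝ v w e) z e =
      f z * fderiv ℝ (fun w => fderiv ℝ v w e) z e + fderiv ℝ v z e * fderiv ℝ f z e := by
  rw [fderiv_fun_mul hf (hv.differentiableAt_fderiv_apply e)]
  simp

theorem fderiv_sub_sub_const_mul_apply {p q φ : E → ℝ} {z : E} (c : ℝ)
    (hp : DifferentiableAt ℝ p z) (hq : DifferentiableAt ℝ q z) (hφ : DifferentiableAt ℝ φ z)
    (e : E) :
    fderiv ℝ (fun w => p w - q w - c * φ w) z e =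
      fderiv ℝ p z e - fderiv ℝ q z e - c * fderiv ℝ φ z e := by
  rw [fderiv_fun_sub (hp.fun_sub hq) (hφ.const_mul c), fderiv_fun_sub hp hq,
    fderiv_const_mul hφ]
  simp

theorem fderiv_mul_fderiv_sub_sub_const_mul_apply {f p q φ : E → ℝ} {z : E} (c : ℝ)
    (hf : DifferentiableAt ℝ f z) (hp : ContDiffAt ℝ 2 p z) (hq : ContDiffAt ℝ 2 q z)
    (hφ : ContDiffAt ℝ 2 φ z) (e : E) :
    fderiv ℝ (fun w => f w * fderiv ℝ (fun w => p w - q w - c * φ w) w e) z e =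
      fderiv ℝ (fun w => f w * fderiv ℝ p w e) z e -
        fderiv ℝ (fun w => f w * fderiv ℝ q w e) z e -
        c * fderiv ℝ (fun w => f w * fderiv ℝ φ w e) z e := by
  have heq : (fun w => f w * fderiv ℝ (fun w => p w - q w - c * φ w) w e) =ᶠ[𝓝 z] fun w =>
      f w * fderiv ℝ p w e - f w * fderiv ℝ q w e - c * (f w * fderiv ℝ φ w e) := by
    filter_upwards [hp.eventually_differentiableAt, hq.eventually_differentiableAt,
      hφ.eventually_differentiableAt] with w h1 h2 h3
    rw [fderiv_sub_sub_const_mul_apply c h1 h2 h3]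
    ring
  rw [heq.fderiv_eq]
  exact fderiv_sub_sub_const_mul_apply c (hf.fun_mul (hp.differentiableAt_fderiv_apply e))
    (hf.fun_mul (hq.differentiableAt_fderiv_apply e))
    (hf.fun_mul (hφ.differentiableAt_fderiv_apply e)) e

end SecondOrder

section Reynolds

variable {f1 f2 : ℝ × ℝ → ℝ} {z : ℝ × ℝ}

theorem ReynoldsOp_nonneg_of_isLocalMin {v : ℝ × ℝ → ℝ}
    (hf1 : DifferentiableAt ℝ f1 z) (hf2 : DifferentiableAt ℝ f2 z)
    (hf1pos : 0 < f1 z) (hf2pos : 0 < f2 z)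
    (hv : ContDiffAt ℝ 2 v z) (h : IsLocalMin v z) : 0 ≤ ReynoldsOp f1 f2 v z := by
  simp only [ReynoldsOp, pdx, pdy]
  rw [fderiv_mul_fderiv_apply hf1 hv, fderiv_mul_fderiv_apply hf2 hv, h.fderiv_eq_zero]
  have h1 := mul_nonneg hf1pos.le (h.fderiv_fderiv_apply_nonneg hv (1, 0))
  have h2 := mul_nonneg hf2pos.le (h.fderiv_fderiv_apply_nonneg hv (0, 1))
  simpa using add_nonneg h1 h2

theorem ReynoldsOp_sub_sub_const_mul {p q φ : ℝ × ℝ → ℝ} (c : ℝ)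
    (hf1 : DifferentiableAt ℝ f1 z) (hf2 : DifferentiableAt ℝ f2 z)
    (hp : ContDiffAt ℝ 2 p z) (hq : ContDiffAt ℝ 2 q z) (hφ : ContDiffAt ℝ 2 φ z) :
    ReynoldsOp f1 f2 (fun w => p w - q w - c * φ w) z =
      ReynoldsOp f1 f2 p z - ReynoldsOp f1 f2 q z - c * ReynoldsOp f1 f2 φ z := by
  simp only [ReynoldsOp, pdx, pdy]
  rw [fderiv_mul_fderiv_sub_sub_const_mul_apply c hf1 hp hq hφ,
    fderiv_mul_fderiv_sub_sub_const_mul_apply c hf2 hp hq hφ]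
  ring

theorem contDiff_exp_mul_fst (a : ℝ) : ContDiff ℝ 2 fun w : ℝ × ℝ => Real.exp (a * w.1) := by
  fun_prop

theorem fderiv_exp_mul_fst_apply (a : ℝ) (w e : ℝ × ℝ) :
    fderiv ℝ (fun w : ℝ × ℝ => Real.exp (a * w.1)) w e = a * e.1 * Real.exp (a * w.1) := by
  have h : HasFDerivAt (fun w : ℝ × ℝ => Real.exp (a * w.1))
      (Real.exp (a * w.1) • a • ContinuousLinearMap.fst ℝ ℝ ℝ) w :=
    (hasFDerivAt_fst.const_mul a).exp
  rw [h.fderiv]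
  simp
  ring

theorem ReynoldsOp_exp_mul_fst (a : ℝ) (hf1 : DifferentiableAt ℝ f1 z) :
    ReynoldsOp f1 f2 (fun w => Real.exp (a * w.1)) z =
      a * Real.exp (a * z.1) * (a * f1 z + fderiv ℝ f1 z (1, 0)) := by
  have hφ : DifferentiableAt ℝ (fun w : ℝ × ℝ => a * Real.exp (a * w.1)) z := by fun_prop
  have hφ' : DifferentiableAt ℝ (fun w : ℝ × ℝ => Real.exp (a * w.1)) z := by fun_prop
  simp only [ReynoldsOp, pdx, pdy, fderiv_exp_mul_fst_apply, mul_one, mul_zero, zero_mul]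
  rw [fderiv_fun_mul hf1 hφ, fderiv_const_mul hφ']
  simp [fderiv_exp_mul_fst_apply]
  ring

/-- On a compact set some exponential of the first coordinate is a strict subsolution. -/
theorem exists_ReynoldsOp_exp_mul_fst_pos (f2 : ℝ × ℝ → ℝ) (hf1 : ContDiff ℝ 1 f1)
    (hf1pos : ∀ z, 0 < f1 z) {K : Set (ℝ × ℝ)} (hK : IsCompact K) :
    ∃ a : ℝ, ∀ z ∈ K, 0 < ReynoldsOp f1 f2 (fun w => Real.exp (a * w.1)) z := by
  have hcont : Continuous fun w => -fderiv ℝ f1 w (1, 0) / f1 w :=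
    ((hf1.continuous_fderiv (by norm_num)).clm_apply continuous_const).neg.div
      hf1.continuous fun w => (hf1pos w).ne'
  obtain ⟨b, hb⟩ := hK.bddAbove_image hcont.continuousOn
  refine ⟨max b 0 + 1, fun w hw => ?_⟩
  rw [ReynoldsOp_exp_mul_fst _ (hf1.differentiable (by norm_num) w)]
  have h1 : -fderiv ℝ f1 w (1, 0) / f1 w < max b 0 + 1 :=
    ((hb (mem_image_of_mem _ hw)).trans (le_max_left b 0)).trans_lt (lt_add_one _)
  rw [div_lt_iff₀ (hf1pos w)] at h1
  have h2 : 0 < max b 0 + 1 := by positivity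
  exact mul_pos (mul_pos h2 (Real.exp_pos _)) (by linarith)

end Reynolds

/-- Closure of positive boundary conditions under addition (continuous case): the solution
on the union of two domains with nonnegative solutions dominates the pointwise maximum of
the two solutions, and in particular is nonnegative everywhere. -/
theorem reynolds_union_of_positive_boundary_conditions
    (f1 f2 f3 : ℝ × ℝ → ℝ)
    (hf1 : ContDiff ℝ 1 f1) (hf2 : ContDiff ℝ 1 f2)
    (hf1pos : ∀ z, 0 < f1 z) (hf2pos : ∀ z, 0 < f2 z)
    (hf3 : Continuous f3)
    (ΩA ΩB : Set (ℝ × ℝ))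
    (hΩAopen : IsOpen ΩA) (hΩAbd : Bornology.IsBounded ΩA)
    (hΩBopen : IsOpen ΩB) (hΩBbd : Bornology.IsBounded ΩB)
    (pA pB p : ℝ × ℝ → ℝ)
    (hpAcont : Continuous pA) (hpA0 : ∀ z ∉ ΩA, pA z = 0)
    (hpAC2 : ContDiffOn ℝ 2 pA ΩA)
    (hpAsol : ∀ z ∈ ΩA, ReynoldsOp f1 f2 pA z = f3 z)
    (hpAnn : ∀ z, 0 ≤ pA z)
    (hpBcont : Continuous pB) (hpB0 : ∀ z ∉ ΩB, pB z = 0)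
    (hpBC2 : ContDiffOn ℝ 2 pB ΩB)
    (hpBsol : ∀ z ∈ ΩB, ReynoldsOp f1 f2 pB z = f3 z)
    (hpBnn : ∀ z, 0 ≤ pB z)
    (hpcont : Continuous p) (hp0 : ∀ z ∉ ΩA ∪ ΩB, p z = 0)
    (hpC2 : ContDiffOn ℝ 2 p (ΩA ∪ ΩB))
    (hpsol : ∀ z ∈ ΩA ∪ ΩB, ReynoldsOp f1 f2 p z = f3 z) :
    ∀ z : ℝ × ℝ, max (pA z) (pB z) ≤ p z ∧ 0 ≤ max (pA z) (pB z) := by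
  have hf1d : Differentiable ℝ f1 := hf1.differentiable (by norm_num)
  have hf2d : Differentiable ℝ f2 := hf2.differentiable (by norm_num)
  have hK : IsCompact (closure (ΩA ∪ ΩB)) := (hΩAbd.union hΩBbd).isCompact_closure
  obtain ⟨a, ha⟩ := exists_ReynoldsOp_exp_mul_fst_pos f2 hf1 hf1pos hK
  set φ : ℝ × ℝ → ℝ := fun w => Real.exp (a * w.1) with hφ
  have hφC2 : ContDiff ℝ 2 φ := contDiff_exp_mul_fst a
  have hφpos : ∀ w, 0 < φ w := fun w => Real.exp_pos _
  -- A solution `q` on an open part `Ω` of the union cannot touch `p - c * φ` from below there.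
  have key : ∀ (Ω : Set (ℝ × ℝ)) (q : ℝ × ℝ → ℝ), IsOpen Ω → Ω ⊆ ΩA ∪ ΩB →
      ContDiffOn ℝ 2 q Ω → (∀ w ∈ Ω, ReynoldsOp f1 f2 q w = f3 w) →
      ∀ c > 0, ∀ w ∈ Ω, ¬ IsLocalMin (fun w => p w - q w - c * φ w) w := by
    intro Ω q hΩ hsub hq hsol c hc w hw hmin
    have hpw : ContDiffAt ℝ 2 p w :=
      hpC2.contDiffAt ((hΩAopen.union hΩBopen).mem_nhds (hsub hw))
    have hqw : ContDiffAt ℝ 2 q w := hq.contDiffAt (hΩ.mem_nhds hw)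
    have hnn := ReynoldsOp_nonneg_of_isLocalMin (hf1d w) (hf2d w) (hf1pos w) (hf2pos w)
      ((hpw.sub hqw).sub (contDiffAt_const.mul hφC2.contDiffAt)) hmin
    rw [ReynoldsOp_sub_sub_const_mul c (hf1d w) (hf2d w) hpw hqw hφC2.contDiffAt,
      hsol w hw, hpsol w (hsub hw)] at hnn
    have := mul_pos hc (ha w (subset_closure (hsub hw)))
    linarith
  intro z
  refine ⟨?_, (hpAnn z).trans (le_max_left _ _)⟩
  by_contra! hlt
  have hzero : ∀ w ∉ ΩA ∪ ΩB, p w - max (pA w) (pB w) = 0 := fun w hw => by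
    rw [hp0 w hw, hpA0 w fun h => hw (Or.inl h), hpB0 w fun h => hw (Or.inr h)]
    simp
  have hz : z ∈ closure (ΩA ∪ ΩB) := by
    by_contra h
    have := hzero z fun h' => h (subset_closure h')
    linarith
  obtain ⟨M, hM⟩ := hK.bddAbove_image hφC2.continuous.continuousOn
  have hM' : ∀ w ∈ closure (ΩA ∪ ΩB), φ w ≤ M := fun w hw => hM (mem_image_of_mem _ hw)
  have hMpos : 0 < M := (hφpos z).trans_le (hM' z hz)
  obtain ⟨c, hc, hcM⟩ : ∃ c > 0, c * M < max (pA z) (pB z) - p z := by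
    refine ⟨(max (pA z) (pB z) - p z) / (2 * M), div_pos (by linarith) (by positivity), ?_⟩
    field_simp
    linarith
  obtain ⟨w, hwK, hw⟩ := hK.exists_isMinOn ⟨z, hz⟩
    (f := fun w => p w - max (pA w) (pB w) - c * φ w)
    ((hpcont.sub (hpAcont.max hpBcont)).sub
      (continuous_const.mul hφC2.continuous)).continuousOn
  have hwΩ : w ∈ ΩA ∪ ΩB := by
    by_contra h
    have h1 : p w - max (pA w) (pB w) - c * φ w ≤ p z - max (pA z) (pB z) - c * φ z := hw hz
    have h2 := mul_pos hc (hφpos z)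
    have h3 := mul_le_mul_of_nonneg_left (hM' w hwK) hc.le
    linarith [hzero w h]
  have hloc : ∀ᶠ y in 𝓝 w, p w - max (pA w) (pB w) - c * φ w ≤
      p y - max (pA y) (pB y) - c * φ y := by
    filter_upwards [(hΩAopen.union hΩBopen).mem_nhds hwΩ] with y hy
    exact hw (subset_closure hy)
  have hlocA : pB w ≤ pA w → IsLocalMin (fun w => p w - pA w - c * φ w) w := fun h => by
    filter_upwards [hloc] with y hy
    rw [max_eq_left h] at hy
    linarith [le_max_left (pA y) (pB y)]
  have hlocB : pA w ≤ pB w → IsLocalMin (fun w => p w - pB w - c * φ w) w := fun h => by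
    filter_upwards [hloc] with y hy
    rw [max_eq_right h] at hy
    linarith [le_max_right (pA y) (pB y)]
  have keyA := key ΩA pA hΩAopen subset_union_left hpAC2 hpAsol c hc w
  have keyB := key ΩB pB hΩBopen subset_union_right hpBC2 hpBsol c hc w
  by_cases hA : w ∈ ΩA
  · by_cases hB : w ∈ ΩB
    · exact (le_total (pB w) (pA w)).elim (fun h => keyA hA (hlocA h))
        fun h => keyB hB (hlocB h)
    · exact keyA hA (hlocA ((hpB0 w hB).trans_le (hpAnn w)))
  · exact keyB (hwΩ.resolve_left hA) (hlocB ((hpA0 w hA).trans_le (hpBnn w)))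
end

section
/- A solution satisfying the natural (Reynolds) boundary conditions is maximal: let Ω_A ⊆ Ω_B ⊆ ℝ² be bounded open sets such that some point of Ω_B does not lie in the closure of Ω_A. Suppose p_A : ℝ² → ℝ is twice continuously differentiable on ℝ², vanishes outside Ω_A, satisfies p_A(x,y) > 0 for all (x,y) ∈ Ω_A, satisfies (L p_A)(x,y) = f₃(x,y) for all (x,y) ∈ Ω_A, and f₃(x,y) ≥ 0 for all (x,y) ∈ Ω_B \ Ω_A. Then there is no function p_B : ℝ² → ℝ that is continuous on ℝ², vanishes outside Ω_B, is twice continuously differentiable on Ω_B, satisfies (L p_B)(x,y) = f₃(x,y) for all (x,y) ∈ Ω_B, and satisfies p_B(x,y) > 0 for all (x,y) ∈ Ω_B. -/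
open Filter Topology in
/-- At a local maximum of `v`, the divergence-form second derivative `∂ₑ (f ∂ₑ v)` is nonpositive
whenever the weight `f` is positive. -/
theorem IsLocalMax.fderiv_mul_fderiv_nonpos {E : Type*} [NormedAddCommGroup E] [NormedSpace ℝ E]
    {f v : E → ℝ} {z : E} (e : E) (hf : ∀ w, 0 < f w)
    (hv : ∀ᶠ w in 𝓝 z, DifferentiableAt ℝ v w) (hmax : IsLocalMax v z) :
    fderiv ℝ (fun w => f w * fderiv ℝ v w e) z e ≤ 0 := by
  by_contra! hpos
  set k : E → ℝ := fun w => f w * fderiv ℝ v w e with hk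
  have hkd : DifferentiableAt ℝ k z := by
    by_contra h
    simp [fderiv_zero_of_not_differentiableAt h] at hpos
  have hkz : k z = 0 := by simp [hk, hmax.fderiv_eq_zero]
  have hline : ∀ t : ℝ, HasDerivAt (fun t : ℝ => z + t • e) e t := fun t => by
    simpa using ((hasDerivAt_id t).smul_const e).const_add z
  have hcont : Tendsto (fun t : ℝ => z + t • e) (𝓝 0) (𝓝 z) := by
    simpa using (hline 0).continuousAt.tendsto
  have hkline : HasDerivAt (fun t : ℝ => k (z + t • e)) (fderiv ℝ k z e) 0 := by
    refine HasFDerivAt.comp_hasDerivAt (l := k) (0 : ℝ) ?_ (hline 0)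
    simpa using hkd.hasFDerivAt
  have hslope : ∀ᶠ t in 𝓝[>] (0 : ℝ), 0 < k (z + t • e) := by
    have h := (hasDerivAt_iff_tendsto_slope.1 hkline).eventually (lt_mem_nhds hpos)
    have h' := h.filter_mono (nhdsWithin_mono (0 : ℝ) fun t (ht : 0 < t) => ht.ne')
    filter_upwards [h', self_mem_nhdsWithin] with t ht ht0
    have ht0 : 0 < t := ht0
    simp only [slope_def_field, zero_smul, add_zero, hkz, sub_zero] at ht
    exact (div_pos_iff_of_pos_right ht0).1 ht
  have hall := (hslope.and ((hcont.eventually (hv.and hmax)).filter_mono nhdsWithin_le_nhds))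
  obtain ⟨δ, hδ, hsub⟩ := mem_nhdsGT_iff_exists_Ioc_subset.1 hall
  have hδ : 0 < δ := hδ
  have hd : ∀ t ∈ Set.Ioc 0 δ,
      HasDerivAt (fun t : ℝ => v (z + t • e)) (fderiv ℝ v (z + t • e) e) t := fun t ht =>
    (hsub ht).2.1.hasFDerivAt.comp_hasDerivAt t (hline t)
  have hc : ContinuousOn (fun t : ℝ => v (z + t • e)) (Set.Icc 0 δ) := by
    intro t ht
    refine ContinuousAt.continuousWithinAt ?_
    rcases ht.1.eq_or_lt with rfl | h0
    · refine ContinuousAt.comp (g := v) ?_ (hline 0).continuousAt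
      simpa using hv.self_of_nhds.continuousAt
    · exact (hd t ⟨h0, ht.2⟩).continuousAt
  obtain ⟨s, hs, hseq⟩ := exists_hasDerivAt_eq_slope _ _ hδ hc fun t ht => hd t ⟨ht.1, ht.2.le⟩
  have hkpos : 0 < f (z + s • e) * fderiv ℝ v (z + s • e) e := (hsub ⟨hs.1, hs.2.le⟩).1
  have hvpos := (pos_iff_pos_of_mul_pos hkpos).1 (hf _)
  rw [hseq, sub_zero, div_pos_iff_of_pos_right hδ] at hvpos
  have hle := (hsub (Set.right_mem_Ioc.2 hδ)).2.2
  simp only [zero_smul, add_zero] at hvpos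
  linarith

open Topology in
theorem ReynoldsOp_nonpos_of_isLocalMax {f1 f2 v : ℝ × ℝ → ℝ} {z : ℝ × ℝ}
    (hf1 : ∀ w, 0 < f1 w) (hf2 : ∀ w, 0 < f2 w)
    (hv : ∀ᶠ w in 𝓝 z, DifferentiableAt ℝ v w) (hmax : IsLocalMax v z) :
    ReynoldsOp f1 f2 v z ≤ 0 :=
  add_nonpos (hmax.fderiv_mul_fderiv_nonpos _ hf1 hv) (hmax.fderiv_mul_fderiv_nonpos _ hf2 hv)

theorem ContDiffAt.mul_fderiv_apply {f p : ℝ × ℝ → ℝ} {z : ℝ × ℝ}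
    (hf : ContDiff ℝ 1 f) (hp : ContDiffAt ℝ 2 p z) (e : ℝ × ℝ) :
    ContDiffAt ℝ 1 (fun w => f w * fderiv ℝ p w e) z :=
  hf.contDiffAt.mul ((hp.fderiv_right (m := 1) (by norm_num)).clm_apply contDiffAt_const)

theorem fderiv_mul_fderiv_add {f p q : ℝ × ℝ → ℝ} {z : ℝ × ℝ}
    (hf : ContDiff ℝ 1 f) (hp : ContDiffAt ℝ 2 p z) (hq : ContDiffAt ℝ 2 q z) (e : ℝ × ℝ) :
    fderiv ℝ (fun w => f w * fderiv ℝ (p + q) w e) z e =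
      fderiv ℝ (fun w => f w * fderiv ℝ p w e) z e +
        fderiv ℝ (fun w => f w * fderiv ℝ q w e) z e := by
  have heq : (fun w => f w * fderiv ℝ (p + q) w e) =ᶠ[nhds z]
      (fun w => f w * fderiv ℝ p w e) + fun w => f w * fderiv ℝ q w e := by
    filter_upwards [hp.eventually (by simp), hq.eventually (by simp)] with w hpw hqw
    rw [fderiv_add (hpw.differentiableAt (by simp)) (hqw.differentiableAt (by simp))]
    simp [mul_add]
  rw [heq.fderiv_eq, fderiv_add ((hp.mul_fderiv_apply hf e).differentiableAt (by simp))
    ((hq.mul_fderiv_apply hf e).differentiableAt (by simp))]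
  rfl

theorem ReynoldsOp_add {f1 f2 p q : ℝ × ℝ → ℝ} {z : ℝ × ℝ}
    (hf1 : ContDiff ℝ 1 f1) (hf2 : ContDiff ℝ 1 f2)
    (hp : ContDiffAt ℝ 2 p z) (hq : ContDiffAt ℝ 2 q z) :
    ReynoldsOp f1 f2 (p + q) z = ReynoldsOp f1 f2 p z + ReynoldsOp f1 f2 q z := by
  have h1 := fderiv_mul_fderiv_add hf1 hp hq (1, 0)
  have h2 := fderiv_mul_fderiv_add hf2 hp hq (0, 1)
  simp only [ReynoldsOp, pdx, pdy, h1, h2]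
  ring

theorem ReynoldsOp_const_smul (f1 f2 p : ℝ × ℝ → ℝ) (c : ℝ) (z : ℝ × ℝ) :
    ReynoldsOp f1 f2 (c • p) z = c * ReynoldsOp f1 f2 p z := by
  have h (f : ℝ × ℝ → ℝ) (e : ℝ × ℝ) : (fun w => f w * fderiv ℝ (c • p) w e) =
      c • fun w => f w * fderiv ℝ p w e := by
    ext w
    simp [fderiv_const_smul_field, mul_left_comm]
  simp only [ReynoldsOp, pdx, pdy]
  rw [h f1, h f2, fderiv_const_smul_field, fderiv_const_smul_field]
  simp [mul_add]

theorem continuous_ReynoldsOp {f1 f2 p : ℝ × ℝ → ℝ}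
    (hf1 : ContDiff ℝ 1 f1) (hf2 : ContDiff ℝ 1 f2) (hp : ContDiff ℝ 2 p) :
    Continuous (ReynoldsOp f1 f2 p) := by
  have h {f : ℝ × ℝ → ℝ} (hf : ContDiff ℝ 1 f) (e : ℝ × ℝ) :
      Continuous fun z => fderiv ℝ (fun w => f w * fderiv ℝ p w e) z e :=
    ((contDiff_iff_contDiffAt.2 fun z =>
      hp.contDiffAt.mul_fderiv_apply hf e).continuous_fderiv (by simp)).clm_apply continuous_const
  exact (h hf1 (1, 0)).add (h hf2 (0, 1))

theorem ReynoldsOp_exp {f1 : ℝ × ℝ → ℝ} (f2 : ℝ × ℝ → ℝ) (hf1 : ContDiff ℝ 1 f1) (l : ℝ)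
    (z : ℝ × ℝ) :
    ReynoldsOp f1 f2 (fun w => Real.exp (l * w.1)) z =
      l * Real.exp (l * z.1) * (pdx f1 z + l * f1 z) := by
  have hφ (w : ℝ × ℝ) : HasFDerivAt (fun w : ℝ × ℝ => Real.exp (l * w.1))
      (Real.exp (l * w.1) • l • ContinuousLinearMap.fst ℝ ℝ ℝ) w :=
    ((hasFDerivAt_fst (𝕜 := ℝ) (p := w)).const_mul l).exp
  have hx : (fun w => f1 w * pdx (fun w => Real.exp (l * w.1)) w) =
      fun w => f1 w * (Real.exp (l * w.1) * l) := by
    ext w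
    simp [pdx, (hφ w).fderiv]
  have hy : (fun w => f2 w * pdy (fun w => Real.exp (l * w.1)) w) = fun _ => 0 := by
    ext w
    simp [pdy, (hφ w).fderiv]
  have hf1z : HasFDerivAt f1 (fderiv ℝ f1 z) z :=
    (hf1.contDiffAt.differentiableAt (by simp)).hasFDerivAt
  have hmul : HasFDerivAt (fun w : ℝ × ℝ => f1 w * (Real.exp (l * w.1) * l)) _ z :=
    hf1z.mul ((hφ z).mul_const l)
  simp only [ReynoldsOp, hx, hy]
  simp only [pdx, pdy, hmul.fderiv]
  simp
  ring

/-- Weak maximum principle for the steady Reynolds operator. -/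
theorem nonpos_of_ReynoldsOp_nonneg {f1 f2 w : ℝ × ℝ → ℝ} {Ω : Set (ℝ × ℝ)}
    (hf1 : ContDiff ℝ 1 f1) (hf2 : ContDiff ℝ 1 f2)
    (hf1pos : ∀ z, 0 < f1 z) (hf2pos : ∀ z, 0 < f2 z)
    (hΩ : IsOpen Ω) (hΩbd : Bornology.IsBounded Ω)
    (hwc : Continuous w) (hw : ContDiffOn ℝ 2 w Ω) (hw0 : ∀ z ∉ Ω, w z ≤ 0)
    (hL : ∀ z ∈ Ω, 0 ≤ ReynoldsOp f1 f2 w z) (z : ℝ × ℝ) : w z ≤ 0 := by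
  by_contra! hz
  have hzΩ : z ∈ Ω := by
    by_contra h
    exact (hw0 z h).not_gt hz
  have hK : IsCompact (closure Ω) := hΩbd.isCompact_closure
  have hpdx : Continuous (pdx f1) := (hf1.continuous_fderiv (by simp)).clm_apply continuous_const
  obtain ⟨m, hm⟩ := (hK.image (hpdx.neg.div hf1.continuous fun z => (hf1pos z).ne')).bddAbove
  set l : ℝ := max m 0 + 1 with hl
  have hl0 : 0 < l := by positivity
  set φ : ℝ × ℝ → ℝ := fun w => Real.exp (l * w.1) with hφ
  have hφs : ContDiff ℝ 2 φ := (contDiff_const.mul contDiff_fst).exp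
  have hLφ : ∀ y ∈ Ω, 0 < ReynoldsOp f1 f2 φ y := fun y hy => by
    rw [ReynoldsOp_exp f2 hf1]
    have h1 : -pdx f1 y / f1 y < l :=
      (hm ⟨y, subset_closure hy, rfl⟩).trans_lt ((le_max_left m 0).trans_lt (lt_add_one _))
    rw [div_lt_iff₀ (hf1pos y)] at h1
    have : 0 < pdx f1 y + l * f1 y := by linarith
    positivity
  obtain ⟨M, hM⟩ := (hK.image hφs.continuous).bddAbove
  have hM : ∀ y ∈ closure Ω, φ y ≤ M := fun y hy => hM ⟨y, hy, rfl⟩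
  have hM0 : 0 < M := (Real.exp_pos _).trans_le (hM z (subset_closure hzΩ))
  set ε : ℝ := w z / M with hε
  have hε0 : 0 < ε := div_pos hz hM0
  obtain ⟨y, hy, hymax⟩ := hK.exists_isMaxOn ⟨z, subset_closure hzΩ⟩
    (hwc.add (hφs.continuous.const_smul ε)).continuousOn
  have hyz : w z + ε * φ z ≤ w y + ε * φ y := hymax (subset_closure hzΩ)
  have hyΩ : y ∈ Ω := by
    by_contra h
    have h1 := hw0 y h
    have h2 : ε * φ y ≤ ε * M := mul_le_mul_of_nonneg_left (hM y hy) hε0.le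
    have h3 : ε * M = w z := div_mul_cancel₀ _ hM0.ne'
    have h4 : 0 < ε * φ z := mul_pos hε0 (Real.exp_pos _)
    linarith
  have hnhds := hΩ.mem_nhds hyΩ
  have hloc : IsLocalMax (w + ε • φ) y :=
    hymax.isLocalMax (Filter.mem_of_superset hnhds subset_closure)
  have hεφ : ContDiff ℝ 2 (ε • φ) := hφs.const_smul ε
  have hdiff : ∀ᶠ x in nhds y, DifferentiableAt ℝ (w + ε • φ) x := by
    filter_upwards [hnhds] with x hx
    exact ((hw.contDiffAt (hΩ.mem_nhds hx)).add hεφ.contDiffAt).differentiableAt (by simp)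
  have hle := ReynoldsOp_nonpos_of_isLocalMax hf1pos hf2pos hdiff hloc
  rw [ReynoldsOp_add hf1 hf2 (hw.contDiffAt hnhds) hεφ.contDiffAt, ReynoldsOp_const_smul] at hle
  have := mul_pos hε0 (hLφ y hyΩ)
  linarith [hL y hyΩ]

/-- A solution satisfying the natural (Reynolds) boundary conditions is maximal: there is
no strictly larger domain `Ω_B` carrying an everywhere-positive solution. -/
theorem natural_boundary_solution_is_maximal
    (f1 f2 f3 : ℝ × ℝ → ℝ)
    (hf1 : ContDiff ℝ 1 f1) (hf2 : ContDiff ℝ 1 f2)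
    (hf1pos : ∀ z, 0 < f1 z) (hf2pos : ∀ z, 0 < f2 z)
    (hf3 : Continuous f3)
    (ΩA ΩB : Set (ℝ × ℝ))
    (hΩAopen : IsOpen ΩA) (hΩAbd : Bornology.IsBounded ΩA)
    (hΩBopen : IsOpen ΩB) (hΩBbd : Bornology.IsBounded ΩB)
    (hAB : ΩA ⊆ ΩB)
    (hstrict : ∃ z ∈ ΩB, z ∉ closure ΩA)
    (pA : ℝ × ℝ → ℝ)
    (hpAC2 : ContDiff ℝ 2 pA)
    (hpA0 : ∀ z ∉ ΩA, pA z = 0)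
    (hpApos : ∀ z ∈ ΩA, 0 < pA z)
    (hpAsol : ∀ z ∈ ΩA, ReynoldsOp f1 f2 pA z = f3 z)
    (hf3nn : ∀ z ∈ ΩB \ ΩA, 0 ≤ f3 z) :
    ¬ ∃ pB : ℝ × ℝ → ℝ,
        Continuous pB ∧ (∀ z ∉ ΩB, pB z = 0) ∧
        ContDiffOn ℝ 2 pB ΩB ∧
        (∀ z ∈ ΩB, ReynoldsOp f1 f2 pB z = f3 z) ∧
        (∀ z ∈ ΩB, 0 < pB z) := by
  rintro ⟨pB, hpBc, hpB0, hpBC2, hpBsol, hpBpos⟩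
  obtain ⟨z, hzB, hzA⟩ := hstrict
  have hclosure : ∀ y ∈ closure ΩA, ReynoldsOp f1 f2 pA y = f3 y := fun y hy =>
    closure_minimal (t := {y | ReynoldsOp f1 f2 pA y = f3 y}) hpAsol
      (isClosed_eq (continuous_ReynoldsOp hf1 hf2 hpAC2) hf3) hy
  have hLA : ∀ y ∈ ΩB, ReynoldsOp f1 f2 pA y ≤ f3 y := by
    intro y hy
    by_cases hyA : y ∈ closure ΩA
    · exact (hclosure y hyA).le
    · have hloc : ∀ᶠ x in nhds y, pA x = 0 := by
        filter_upwards [isClosed_closure.isOpen_compl.mem_nhds hyA] with x hx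
        exact hpA0 x fun h => hx (subset_closure h)
      have hmax : IsLocalMax pA y := by
        filter_upwards [hloc] with x hx
        rw [hx, hloc.self_of_nhds]
      exact (ReynoldsOp_nonpos_of_isLocalMax hf1pos hf2pos
        (.of_forall (hpAC2.differentiable (by simp))) hmax).trans
        (hf3nn y ⟨hy, fun h => hyA (subset_closure h)⟩)
  have hnA : ContDiff ℝ 2 ((-1 : ℝ) • pA) := hpAC2.const_smul (-1 : ℝ)
  have hle := nonpos_of_ReynoldsOp_nonneg (w := pB + (-1 : ℝ) • pA) hf1 hf2 hf1pos hf2pos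
    hΩBopen hΩBbd (hpBc.add hnA.continuous) (hpBC2.add hnA.contDiffOn)
    (fun y hy => by simp [hpB0 y hy, hpA0 y fun h => hy (hAB h)])
    (fun y hy => by
      rw [ReynoldsOp_add hf1 hf2 (hpBC2.contDiffAt (hΩBopen.mem_nhds hy)) hnA.contDiffAt,
        ReynoldsOp_const_smul, hpBsol y hy]
      linarith [hLA y hy]) z
  have hzero : pA z = 0 := hpA0 z fun h => hzA (subset_closure h)
  simp only [Pi.add_apply, Pi.smul_apply, hzero, smul_zero, add_zero] at hle
  exact (hpBpos z hzB).not_ge hle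
end

section
/- Uniqueness of the solution of the Reynolds equation under natural boundary conditions: say that a pair (Ω, p), with Ω ⊆ ℝ² a bounded open set and p : ℝ² → ℝ, satisfies the natural boundary conditions if p is twice continuously differentiable on ℝ², p vanishes outside Ω, p(x,y) > 0 for all (x,y) ∈ Ω, (L p)(x,y) = f₃(x,y) for all (x,y) ∈ Ω, and f₃(x,y) ≥ 0 for all (x,y) ∉ Ω. If (Ω_A, p_A) and (Ω_B, p_B) both satisfy the natural boundary conditions, then p_A = p_B and Ω_A = Ω_B. -/
/-- The pair `(Ω, p)` satisfies the natural (Reynolds) boundary conditions for the data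
`f₃`: `p` is twice continuously differentiable, vanishes outside `Ω`, is positive on `Ω`,
solves the Reynolds equation on `Ω`, and `f₃ ≥ 0` outside `Ω`. -/
def SatisfiesNaturalBC (f1 f2 f3 : ℝ × ℝ → ℝ) (Ω : Set (ℝ × ℝ)) (p : ℝ × ℝ → ℝ) : Prop :=
  ContDiff ℝ 2 p ∧
  (∀ z ∉ Ω, p z = 0) ∧
  (∀ z ∈ Ω, 0 < p z) ∧
  (∀ z ∈ Ω, ReynoldsOp f1 f2 p z = f3 z) ∧
  (∀ z ∉ Ω, 0 ≤ f3 z)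

theorem contDiff_one_pdx {g : ℝ × ℝ → ℝ} (hg : ContDiff ℝ 2 g) : ContDiff ℝ 1 (pdx g) :=
  (hg.fderiv_right (m := 1) (by norm_num)).clm_apply contDiff_const

theorem contDiff_one_pdy {g : ℝ × ℝ → ℝ} (hg : ContDiff ℝ 2 g) : ContDiff ℝ 1 (pdy g) :=
  (hg.fderiv_right (m := 1) (by norm_num)).clm_apply contDiff_const

theorem continuous_pdx {g : ℝ × ℝ → ℝ} (hg : ContDiff ℝ 1 g) : Continuous (pdx g) :=
  (hg.continuous_fderiv (by norm_num)).clm_apply continuous_const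

theorem continuous_pdy {g : ℝ × ℝ → ℝ} (hg : ContDiff ℝ 1 g) : Continuous (pdy g) :=
  (hg.continuous_fderiv (by norm_num)).clm_apply continuous_const

theorem pdx_sub {g h : ℝ × ℝ → ℝ} (hg : Differentiable ℝ g) (hh : Differentiable ℝ h) :
    pdx (fun z => g z - h z) = fun z => pdx g z - pdx h z := by
  funext z
  simp only [pdx]
  rw [fderiv_fun_sub (hg z) (hh z)]
  rfl

theorem pdy_sub {g h : ℝ × ℝ → ℝ} (hg : Differentiable ℝ g) (hh : Differentiable ℝ h) :
    pdy (fun z => g z - h z) = fun z => pdy g z - pdy h z := by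
  funext z
  simp only [pdy]
  rw [fderiv_fun_sub (hg z) (hh z)]
  rfl

theorem ReynoldsOp_sub {f1 f2 p q : ℝ × ℝ → ℝ} (hf1 : ContDiff ℝ 1 f1) (hf2 : ContDiff ℝ 1 f2)
    (hp : ContDiff ℝ 2 p) (hq : ContDiff ℝ 2 q) (z : ℝ × ℝ) :
    ReynoldsOp f1 f2 (fun w => p w - q w) z = ReynoldsOp f1 f2 p z - ReynoldsOp f1 f2 q z := by
  have hdp := hp.differentiable (by norm_num)
  have hdq := hq.differentiable (by norm_num)
  simp only [ReynoldsOp, pdx_sub hdp hdq, pdy_sub hdp hdq, mul_sub]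
  rw [pdx_sub ((hf1.mul (contDiff_one_pdx hp)).differentiable (by norm_num))
      ((hf1.mul (contDiff_one_pdx hq)).differentiable (by norm_num)),
    pdy_sub ((hf2.mul (contDiff_one_pdy hp)).differentiable (by norm_num))
      ((hf2.mul (contDiff_one_pdy hq)).differentiable (by norm_num))]
  ring

theorem ReynoldsOp_eq_zero_of_eventuallyEq {f1 f2 p : ℝ × ℝ → ℝ} {z : ℝ × ℝ}
    (h : p =ᶠ[nhds z] fun _ => 0) : ReynoldsOp f1 f2 p z = 0 := by
  have hx : (fun w => f1 w * pdx p w) =ᶠ[nhds z] fun _ => 0 := by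
    filter_upwards [h.fderiv (𝕜 := ℝ)] with w hw
    simp [pdx, hw]
  have hy : (fun w => f2 w * pdy p w) =ᶠ[nhds z] fun _ => 0 := by
    filter_upwards [h.fderiv (𝕜 := ℝ)] with w hw
    simp [pdy, hw]
  rw [ReynoldsOp, pdx, pdy, hx.fderiv_eq, hy.fderiv_eq]
  simp

/-- A solution either satisfies the Reynolds equation at `z`, or `z` lies in the cavitated region,
where `p` and `L p` vanish and `f₃ ≥ 0`. -/
theorem SatisfiesNaturalBC.reynoldsOp_eq_or {f1 f2 f3 p : ℝ × ℝ → ℝ} {Ω : Set (ℝ × ℝ)}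
    (h : SatisfiesNaturalBC f1 f2 f3 Ω p) (hf1 : ContDiff ℝ 1 f1) (hf2 : ContDiff ℝ 1 f2)
    (hf3 : Continuous f3) (z : ℝ × ℝ) :
    ReynoldsOp f1 f2 p z = f3 z ∨ (p z = 0 ∧ ReynoldsOp f1 f2 p z = 0 ∧ 0 ≤ f3 z) := by
  obtain ⟨hp, hzero, -, heq, hnonneg⟩ := h
  by_cases hz : z ∈ closure Ω
  · exact .inl (closure_minimal heq (isClosed_eq (continuous_ReynoldsOp hf1 hf2 hp) hf3) hz)
  · have hzΩ : z ∉ Ω := fun hmem => hz (subset_closure hmem)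
    refine .inr ⟨hzero z hzΩ, ReynoldsOp_eq_zero_of_eventuallyEq ?_, hnonneg z hzΩ⟩
    filter_upwards [isClosed_closure.isOpen_compl.mem_nhds hz] with w hw
    exact hzero w fun hmem => hw (subset_closure hmem)

theorem SatisfiesNaturalBC.nonneg {f1 f2 f3 p : ℝ × ℝ → ℝ} {Ω : Set (ℝ × ℝ)}
    (h : SatisfiesNaturalBC f1 f2 f3 Ω p) (z : ℝ × ℝ) : 0 ≤ p z := by
  by_cases hz : z ∈ Ω
  · exact (h.2.2.1 z hz).le
  · exact (h.2.1 z hz).ge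

theorem SatisfiesNaturalBC.eq_setOf_pos {f1 f2 f3 p : ℝ × ℝ → ℝ} {Ω : Set (ℝ × ℝ)}
    (h : SatisfiesNaturalBC f1 f2 f3 Ω p) : Ω = {z | 0 < p z} := by
  ext z
  refine ⟨h.2.2.1 z, fun (hz : 0 < p z) => ?_⟩
  by_contra hzΩ
  exact hz.ne' (h.2.1 z hzΩ)

theorem SatisfiesNaturalBC.hasCompactSupport {f1 f2 f3 p : ℝ × ℝ → ℝ} {Ω : Set (ℝ × ℝ)}
    (h : SatisfiesNaturalBC f1 f2 f3 Ω p) (hΩ : Bornology.IsBounded Ω) : HasCompactSupport p :=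
  .intro hΩ.isCompact_closure fun z hz => h.2.1 z fun hmem => hz (subset_closure hmem)

theorem integral_mul_fderiv_mul_fderiv {E : Type*} [NormedAddCommGroup E] [NormedSpace ℝ E]
    [FiniteDimensional ℝ E] [MeasurableSpace E] [BorelSpace E] (μ : MeasureTheory.Measure E)
    [μ.IsAddHaarMeasure] {f w : E → ℝ} (hf : ContDiff ℝ 1 f) (hw : ContDiff ℝ 2 w)
    (hsupp : HasCompactSupport w) (v : E) :
    (MeasureTheory.Integrable (fun z => w z * fderiv ℝ (fun x => f x * fderiv ℝ w x v) z v) μ ∧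
      MeasureTheory.Integrable (fun z => f z * fderiv ℝ w z v ^ 2) μ) ∧
    ∫ z, w z * fderiv ℝ (fun x => f x * fderiv ℝ w x v) z v ∂μ =
      -∫ z, f z * fderiv ℝ w z v ^ 2 ∂μ := by
  have hdw : ContDiff ℝ 1 fun x => fderiv ℝ w x v :=
    (hw.fderiv_right (m := 1) (by norm_num)).clm_apply contDiff_const
  have hg : ContDiff ℝ 1 fun x => f x * fderiv ℝ w x v := hf.mul hdw
  have hdsupp : HasCompactSupport fun x => fderiv ℝ w x v := hsupp.fderiv_apply ℝ v
  have hsq : (fun z => f z * fderiv ℝ w z v ^ 2) =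
      fun z => fderiv ℝ w z v * (f z * fderiv ℝ w z v) := by
    funext z
    ring
  have h₁ : MeasureTheory.Integrable
      (fun z => w z * fderiv ℝ (fun x => f x * fderiv ℝ w x v) z v) μ :=
    (hw.continuous.mul ((hg.continuous_fderiv (by norm_num)).clm_apply
      continuous_const)).integrable_of_hasCompactSupport hsupp.mul_right
  have h₂ : MeasureTheory.Integrable (fun z => fderiv ℝ w z v * (f z * fderiv ℝ w z v)) μ :=
    (hdw.continuous.mul hg.continuous).integrable_of_hasCompactSupport hdsupp.mul_right
  have h₃ : MeasureTheory.Integrable (fun z => w z * (f z * fderiv ℝ w z v)) μ :=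
    (hw.continuous.mul hg.continuous).integrable_of_hasCompactSupport hsupp.mul_right
  rw [hsq]
  exact ⟨⟨h₁, h₂⟩, integral_mul_fderiv_eq_neg_fderiv_mul_of_integrable h₂ h₁ h₃
    (fun z _ => hw.differentiable (by norm_num) z) (fun z _ => hg.differentiable (by norm_num) z)⟩

/-- A compactly supported `w` with `w · L w ≥ 0` vanishes, by the energy identity
`∫ w · L w = -∫ (f₁ w_x² + f₂ w_y²)`. -/
theorem eq_zero_of_mul_ReynoldsOp_nonneg {f1 f2 w : ℝ × ℝ → ℝ} (hf1 : ContDiff ℝ 1 f1)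
    (hf2 : ContDiff ℝ 1 f2) (hf1pos : ∀ z, 0 < f1 z) (hf2pos : ∀ z, 0 < f2 z)
    (hw : ContDiff ℝ 2 w) (hsupp : HasCompactSupport w)
    (h : ∀ z, 0 ≤ w z * ReynoldsOp f1 f2 w z) : w = 0 := by
  obtain ⟨⟨hx₁, hx₂⟩, hx⟩ := integral_mul_fderiv_mul_fderiv MeasureTheory.volume hf1 hw hsupp (1, 0)
  obtain ⟨⟨hy₁, hy₂⟩, hy⟩ := integral_mul_fderiv_mul_fderiv MeasureTheory.volume hf2 hw hsupp (0, 1)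
  have hint : ∫ z, w z * ReynoldsOp f1 f2 w z =
      -∫ z, (f1 z * pdx w z ^ 2 + f2 z * pdy w z ^ 2) := by
    simp only [ReynoldsOp, mul_add]
    refine (MeasureTheory.integral_add hx₁ hy₁).trans ?_
    rw [hx, hy, ← neg_add, ← MeasureTheory.integral_add hx₂ hy₂]
    rfl
  have henergy : ∀ z, 0 ≤ f1 z * pdx w z ^ 2 + f2 z * pdy w z ^ 2 := fun z =>
    add_nonneg (mul_nonneg (hf1pos z).le (sq_nonneg _)) (mul_nonneg (hf2pos z).le (sq_nonneg _))
  have hzero : ∫ z, (f1 z * pdx w z ^ 2 + f2 z * pdy w z ^ 2) = 0 := by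
    have h₁ : 0 ≤ ∫ z, w z * ReynoldsOp f1 f2 w z := MeasureTheory.integral_nonneg fun z => h z
    have h₂ : 0 ≤ ∫ z, (f1 z * pdx w z ^ 2 + f2 z * pdy w z ^ 2) :=
      MeasureTheory.integral_nonneg fun z => henergy z
    linarith
  have hcont : Continuous fun z => f1 z * pdx w z ^ 2 + f2 z * pdy w z ^ 2 :=
    (hf1.continuous.mul ((contDiff_one_pdx hw).continuous.pow 2)).add
      (hf2.continuous.mul ((contDiff_one_pdy hw).continuous.pow 2))
  have hvanish := (hcont.ae_eq_iff_eq MeasureTheory.volume continuous_zero).1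
    ((MeasureTheory.integral_eq_zero_iff_of_nonneg henergy (hx₂.add hy₂)).1 hzero)
  have hfderiv : ∀ z, fderiv ℝ w z = 0 := by
    intro z
    have hz : f1 z * pdx w z ^ 2 + f2 z * pdy w z ^ 2 = 0 := congrFun hvanish z
    obtain ⟨hzx, hzy⟩ := (add_eq_zero_iff_of_nonneg (mul_nonneg (hf1pos z).le (sq_nonneg _))
      (mul_nonneg (hf2pos z).le (sq_nonneg _))).1 hz
    have hpx : fderiv ℝ w z (1, 0) = 0 := by simpa [(hf1pos z).ne', pdx] using hzx
    have hpy : fderiv ℝ w z (0, 1) = 0 := by simpa [(hf2pos z).ne', pdy] using hzy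
    ext <;> simp [hpx, hpy]
  have hconst := is_const_of_fderiv_eq_zero (hw.differentiable (by norm_num)) hfderiv
  obtain ⟨z₀, hz₀⟩ : ∃ z, z ∉ tsupport w := by
    by_contra! hall
    exact noncompact_univ (ℝ × ℝ) (Set.eq_univ_of_forall hall ▸ hsupp)
  funext z
  exact (hconst z z₀).trans (image_eq_zero_of_notMem_tsupport hz₀)

/-- Uniqueness of the solution of the Reynolds equation under natural boundary
conditions. -/
theorem natural_boundary_solution_unique
    (f1 f2 f3 : ℝ × ℝ → ℝ)
    (hf1 : ContDiff ℝ 1 f1) (hf2 : ContDiff ℝ 1 f2)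
    (hf1pos : ∀ z, 0 < f1 z) (hf2pos : ∀ z, 0 < f2 z)
    (hf3 : Continuous f3)
    (ΩA ΩB : Set (ℝ × ℝ))
    (hΩAopen : IsOpen ΩA) (hΩAbd : Bornology.IsBounded ΩA)
    (hΩBopen : IsOpen ΩB) (hΩBbd : Bornology.IsBounded ΩB)
    (pA pB : ℝ × ℝ → ℝ)
    (hA : SatisfiesNaturalBC f1 f2 f3 ΩA pA)
    (hB : SatisfiesNaturalBC f1 f2 f3 ΩB pB) :
    pA = pB ∧ ΩA = ΩB := by
  have hwzero : (fun z => pA z - pB z) = 0 := by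
    refine eq_zero_of_mul_ReynoldsOp_nonneg hf1 hf2 hf1pos hf2pos (hA.1.sub hB.1)
      ((hA.hasCompactSupport hΩAbd).sub (hB.hasCompactSupport hΩBbd)) fun z => ?_
    rw [ReynoldsOp_sub hf1 hf2 hA.1 hB.1]
    have hpA := hA.nonneg z
    have hpB := hB.nonneg z
    rcases hA.reynoldsOp_eq_or hf1 hf2 hf3 z with hLA | ⟨hA0, hLA, hf3z⟩ <;>
      rcases hB.reynoldsOp_eq_or hf1 hf2 hf3 z with hLB | ⟨hB0, hLB, hf3z'⟩
    · simp [hLA, hLB]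
    · simpa [hLA, hLB, hB0] using mul_nonneg hpA hf3z'
    · simpa [hLA, hLB, hA0] using mul_nonneg hpB hf3z
    · simp [hLA, hLB]
  have hp : pA = pB := funext fun z => sub_eq_zero.1 (congrFun hwzero z)
  exact ⟨hp, by rw [hA.eq_setOf_pos, hB.eq_setOf_pos, hp]⟩
end
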